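/- arXiv:2112.14257 — 6 statements merged into one kernel-verified Lean document; each statement's English description precedes it below -/
import Mathlib

section
/- Let Θ be a set, let m be a natural number, let c : Θ → (Fin m → ℝ) and ρ₀ : Θ → ℝ. For λ in the standard simplex Δ = {λ : Fin m → ℝ | ∀ i, 0 ≤ λ i, and ∑ i, λ i = 1} define r θ λ = ∑ i, λ i * c θ i. Assume that for every λ ∈ Δ there exists θ ∈ Θ with ρ₀ θ < r θ λ. Then there exists a finite subset Θ₀ ⊆ Θ such that for every λ ∈ Δ there exists θ ∈ Θ₀ with ρ₀ θ < r θ λ. -/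
open Finset

/-- Finite witnessing of admissibility: randomization (simplex) case. -/
theorem finite_witness_admissibility_randomized
    {Θ : Type*} (m : ℕ) (c : Θ → Fin m → ℝ) (ρ₀ : Θ → ℝ)
    (hadm : ∀ l : Fin m → ℝ, ((∀ i, 0 ≤ l i) ∧ ∑ i, l i = 1) →
      ∃ θ : Θ, ρ₀ θ < ∑ i, l i * c θ i) :
    ∃ Θ₀ : Finset Θ, ∀ l : Fin m → ℝ, ((∀ i, 0 ≤ l i) ∧ ∑ i, l i = 1) →
      ∃ θ ∈ Θ₀, ρ₀ θ < ∑ i, l i * c θ i := by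
  obtain ⟨t, ht⟩ := (isCompact_stdSimplex ℝ (Fin m)).elim_finite_subcover
    (fun θ : Θ => {l : Fin m → ℝ | ρ₀ θ < ∑ i, l i * c θ i})
    (fun θ => isOpen_lt continuous_const (by fun_prop))
    (fun l hl => by
      obtain ⟨θ, hθ⟩ := hadm l hl
      exact Set.mem_iUnion.2 ⟨θ, hθ⟩)
  refine ⟨t, fun l hl => ?_⟩
  have h := ht (show l ∈ stdSimplex ℝ (Fin m) from hl)
  simp only [Set.mem_iUnion] at h
  obtain ⟨θ, hθ, h⟩ := h
  exact ⟨θ, hθ, h⟩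
end

section
/- Let Θ be a measurable space in which singletons are measurable, let D be a set, let δ₀ ∈ D, and let r : Θ → D → ℝ be such that θ ↦ r θ δ is measurable for each δ ∈ D. Suppose that for every θ₀ ∈ Θ and every real ε > 0 there exists a probability measure π on Θ such that (i) θ ↦ r θ δ is π-integrable for every δ ∈ D, (ii) π({θ₀}) > 0, and (iii) for every δ ∈ D, ∫ r θ δ₀ dπ(θ) ≤ ∫ r θ δ dπ(θ) + (π({θ₀})).toReal * ε. Then δ₀ is admissible among D, i.e., there is no δ ∈ D with r θ δ ≤ r θ δ₀ for all θ ∈ Θ and r θ δ < r θ δ₀ for some θ ∈ Θ. -/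
open MeasureTheory

/-- Stein's condition implies admissibility (no regularity assumptions). -/
theorem stein_condition_implies_admissible
    {Θ : Type*} [MeasurableSpace Θ] [MeasurableSingletonClass Θ]
    {D : Type*} (δ₀ : D) (r : Θ → D → ℝ)
    (hmeas : ∀ δ : D, Measurable fun θ => r θ δ)
    (hstein : ∀ θ₀ : Θ, ∀ ε : ℝ, 0 < ε →
      ∃ π : Measure Θ, IsProbabilityMeasure π ∧
        (∀ δ : D, Integrable (fun θ => r θ δ) π) ∧
        0 < π {θ₀} ∧
        ∀ δ : D, ∫ θ, r θ δ₀ ∂π ≤ ∫ θ, r θ δ ∂π + (π {θ₀}).toReal * ε) :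
    ¬ ∃ δ : D, (∀ θ : Θ, r θ δ ≤ r θ δ₀) ∧ ∃ θ : Θ, r θ δ < r θ δ₀ := by
  rintro ⟨δ, hle, θ₀, hlt⟩
  obtain ⟨π, hπ, hint, hpos, h⟩ := hstein θ₀ ((r θ₀ δ₀ - r θ₀ δ) / 2) (by linarith)
  have h1 := h δ
  have hi : Integrable (fun θ => r θ δ₀ - r θ δ) π := (hint δ₀).sub (hint δ)
  have h2 : ∫ θ in {θ₀}, (r θ δ₀ - r θ δ) ∂π ≤ ∫ θ, (r θ δ₀ - r θ δ) ∂π :=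
    setIntegral_le_integral hi (Filter.Eventually.of_forall fun θ => sub_nonneg.2 (hle θ))
  rw [integral_sub (hint δ₀) (hint δ), integral_singleton, smul_eq_mul, measureReal_def] at h2
  have h3 : 0 < (π {θ₀}).toReal := ENNReal.toReal_pos hpos.ne' (measure_ne_top _ _)
  have h4 := mul_pos h3 (sub_pos.2 hlt)
  linarith
end

section
/- Let Θ be a measurable space, let D be a set, let δ₀ ∈ D, and let r : Θ → D → ℝ be such that θ ↦ r θ δ is measurable for each δ ∈ D. Let 𝓑 be a determining family: a collection of nonempty measurable subsets of Θ such that for all δ, δ' ∈ D, if there exists θ₀ ∈ Θ with r θ₀ δ' < r θ₀ δ, then there exist B ∈ 𝓑 and ε > 0 with r θ δ' < r θ δ − ε for all θ ∈ B. Suppose that for every B ∈ 𝓑 and every real ε > 0 there exists a probability measure π on Θ such that (i) θ ↦ r θ δ is π-integrable for every δ ∈ D, (ii) π(B) > 0, and (iii) for every δ ∈ D, ∫ r θ δ₀ dπ(θ) ≤ ∫ r θ δ dπ(θ) + (π(B)).toReal * ε. Then δ₀ is admissible among D, i.e., there is no δ ∈ D with r θ δ ≤ r θ δ₀ for all θ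 ∈ Θ and r θ δ < r θ δ₀ for some θ ∈ Θ. -/
open MeasureTheory

/-- Stein's condition with respect to a determining family implies admissibility. -/
theorem stein_condition_determining_family_implies_admissible
    {Θ : Type*} [MeasurableSpace Θ]
    {D : Type*} (δ₀ : D) (r : Θ → D → ℝ)
    (hmeas : ∀ δ : D, Measurable fun θ => r θ δ)
    (𝓑 : Set (Set Θ))
    (h𝓑ne : ∀ B ∈ 𝓑, B.Nonempty)
    (h𝓑meas : ∀ B ∈ 𝓑, MeasurableSet B)
    (h𝓑det : ∀ δ δ' : D, (∃ θ₀ : Θ, r θ₀ δ' < r θ₀ δ) →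
      ∃ B ∈ 𝓑, ∃ ε : ℝ, 0 < ε ∧ ∀ θ ∈ B, r θ δ' < r θ δ - ε)
    (hstein : ∀ B ∈ 𝓑, ∀ ε : ℝ, 0 < ε →
      ∃ π : Measure Θ, IsProbabilityMeasure π ∧
        (∀ δ : D, Integrable (fun θ => r θ δ) π) ∧
        0 < π B ∧
        ∀ δ : D, ∫ θ, r θ δ₀ ∂π ≤ ∫ θ, r θ δ ∂π + (π B).toReal * ε) :
    ¬ ∃ δ : D, (∀ θ : Θ, r θ δ ≤ r θ δ₀) ∧ ∃ θ : Θ, r θ δ < r θ δ₀ := by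
  rintro ⟨δ, hle, hlt⟩
  obtain ⟨B, hB, ε, hε, hBε⟩ := h𝓑det δ₀ δ hlt
  obtain ⟨π, hπ, hint, hpos, hst⟩ := hstein B hB (ε / 2) (half_pos hε)
  have hmB := h𝓑meas B hB
  have hpB : 0 < (π B).toReal := ENNReal.toReal_pos hpos.ne' (measure_ne_top π B)
  have h1 := hst δ
  have hind : Integrable (B.indicator fun _ => ε) π :=
    (integrable_const ε).indicator hmB
  have h2 : ∫ θ, B.indicator (fun _ => ε) θ ∂π ≤ ∫ θ, (r θ δ₀ - r θ δ) ∂π := by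
    refine integral_mono hind ((hint δ₀).sub (hint δ)) ?_
    intro θ
    by_cases hθ : θ ∈ B
    · have := hBε θ hθ
      simp only [Set.indicator_of_mem hθ]
      linarith
    · have := hle θ
      simp only [Set.indicator_of_notMem hθ]
      linarith
  rw [integral_sub (hint δ₀) (hint δ), integral_indicator_const ε hmB, smul_eq_mul,
    measureReal_def] at h2
  nlinarith [mul_pos hpB hε]
end

section
/- Let Θ be a set, let D be a set, let δ₀ ∈ D, and let r : Θ → D → ℝ be such that for each δ ∈ D the function θ ↦ r θ δ is bounded. Suppose that for every θ₀ ∈ Θ and every real ε > 0 there exists an ℝ-linear functional L on the space B(Θ) of bounded real-valued functions on Θ such that L is monotone (f ≤ g implies L f ≤ L g), L(1) = 1, L(𝟙_{{θ₀}}) > 0, and for every δ ∈ D, L(θ ↦ r θ δ₀) ≤ L(θ ↦ r θ δ) + L(𝟙_{{θ₀}}) * ε. Then δ₀ is admissible among D, i.e., there is no δ ∈ D with r θ δ ≤ r θ δ₀ for all θ ∈ Θ and r θ δ < r θ δ₀ for some θ ∈ Θ. -/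
open BoundedContinuousFunction

/-- Bundle a bounded real-valued function on a discrete space as a bounded
continuous function; `B(Θ)` is realized as `Θ →ᵇ ℝ` for the discrete topology. -/
noncomputable def boundedFun {Θ : Type*} [TopologicalSpace Θ] [DiscreteTopology Θ]
    (f : Θ → ℝ) (hf : ∃ C : ℝ, ∀ θ, |f θ| ≤ C) : Θ →ᵇ ℝ :=
  BoundedContinuousFunction.ofNormedAddCommGroup f continuous_of_discreteTopology
    (Classical.choose hf)
    (fun θ => by simpa [Real.norm_eq_abs] using Classical.choose_spec hf θ)

/-- The indicator function of a singleton as a bounded continuous function on a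
discrete space. -/
noncomputable def indicatorBCF {Θ : Type*} [TopologicalSpace Θ] [DiscreteTopology Θ]
    (θ₀ : Θ) : Θ →ᵇ ℝ :=
  boundedFun (Set.indicator {θ₀} fun _ => (1 : ℝ))
    ⟨1, fun θ => by
      by_cases h : θ ∈ ({θ₀} : Set Θ) <;> simp [Set.indicator_apply, h]⟩

/-- The finitely additive Stein condition implies admissibility
(no compactness or continuity assumptions). -/
theorem finitely_additive_stein_implies_admissible
    {Θ : Type*} [TopologicalSpace Θ] [DiscreteTopology Θ]
    {D : Type*} (δ₀ : D) (r : Θ → D → ℝ)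
    (hbdd : ∀ δ : D, ∃ C : ℝ, ∀ θ, |r θ δ| ≤ C)
    (hstein : ∀ θ₀ : Θ, ∀ ε : ℝ, 0 < ε →
      ∃ L : (Θ →ᵇ ℝ) →ₗ[ℝ] ℝ,
        (∀ f g : Θ →ᵇ ℝ, f ≤ g → L f ≤ L g) ∧
        L 1 = 1 ∧
        0 < L (indicatorBCF θ₀) ∧
        ∀ δ : D, L (boundedFun (fun θ => r θ δ₀) (hbdd δ₀)) ≤
          L (boundedFun (fun θ => r θ δ) (hbdd δ)) + L (indicatorBCF θ₀) * ε) :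
    ¬ ∃ δ : D, (∀ θ : Θ, r θ δ ≤ r θ δ₀) ∧ ∃ θ : Θ, r θ δ < r θ δ₀ := by
  rintro ⟨δ, hle, θ₀, hlt⟩
  have hgap : 0 < r θ₀ δ₀ - r θ₀ δ := sub_pos.mpr hlt
  obtain ⟨L, hmono, -, hpos, hL⟩ := hstein θ₀ ((r θ₀ δ₀ - r θ₀ δ) / 2) (half_pos hgap)
  have key : boundedFun (fun θ => r θ δ) (hbdd δ) + (r θ₀ δ₀ - r θ₀ δ) • indicatorBCF θ₀
      ≤ boundedFun (fun θ => r θ δ₀) (hbdd δ₀) := by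
    intro θ
    change r θ δ + (r θ₀ δ₀ - r θ₀ δ) * Set.indicator {θ₀} (fun _ => (1 : ℝ)) θ ≤ r θ δ₀
    by_cases h : θ = θ₀
    · subst h
      simp
    · simpa [Set.indicator_apply, h] using hle θ
  have h1 := hmono _ _ key
  rw [map_add, map_smul, smul_eq_mul] at h1
  have h2 := hL δ
  nlinarith [mul_pos hgap hpos]
end

section
/- Fix a natural number n ≥ 2. For θ = (μ, v₁, v₂) ∈ ℝ × (0,∞) × (0,∞), let P_θ be the product probability measure on (Fin n → ℝ) × (Fin n → ℝ) given by P_θ = (gaussianReal μ v₁)^{⊗n} ⊗ (gaussianReal μ v₂)^{⊗n}. For a sample x = (x₁, x₂) let X̄ᵢ(x) = (1/n) ∑ⱼ xᵢ(j) and Sᵢ²(x) = (1/(n−1)) ∑ⱼ (xᵢ(j) − X̄ᵢ(x))². For a measurable function φ : ℝ × ℝ → [0,1] define the estimator δ_φ(x) = X̄₁(x) + (X̄₂(x) − X̄₁(x)) · φ(S₁²(x), S₂²(x)) and its risk R(θ, φ) = ∫ (δ_φ(x) − μ)² dP_θ(x). Let φ_GD(s₁, s₂) = s₁/(s₁ +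 s₂). Then the Graybill–Deal estimator δ_{φ_GD} is admissible in this class: there is no measurable φ : ℝ × ℝ → [0,1] such that R(θ, φ) ≤ R(θ, φ_GD) for all θ ∈ ℝ × (0,∞) × (0,∞) and R(θ, φ) < R(θ, φ_GD) for some θ. -/
open MeasureTheory ProbabilityTheory

/-- The joint law of two independent samples of size `n` from `N(μ, v₁)` and `N(μ, v₂)`. -/
noncomputable def sampleLaw (n : ℕ) (μ : ℝ) (v₁ v₂ : ℝ) :
    Measure ((Fin n → ℝ) × (Fin n → ℝ)) :=
  (Measure.pi fun _ : Fin n => gaussianReal μ v₁.toNNReal).prod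
    (Measure.pi fun _ : Fin n => gaussianReal μ v₂.toNNReal)

/-- The sample mean of `n` observations. -/
noncomputable def sampleMean (n : ℕ) (x : Fin n → ℝ) : ℝ := (∑ j, x j) / n

/-- The (Bessel-corrected) sample variance of `n` observations. -/
noncomputable def sampleVar (n : ℕ) (x : Fin n → ℝ) : ℝ :=
  (∑ j, (x j - sampleMean n x) ^ 2) / (n - 1)

/-- The estimator `X̄₁ + (X̄₂ - X̄₁) · φ(S₁², S₂²)` of the common mean. -/
noncomputable def estimatorOf (n : ℕ) (φ : ℝ × ℝ → ℝ)
    (x : (Fin n → ℝ) × (Fin n → ℝ)) : ℝ :=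
  sampleMean n x.1 + (sampleMean n x.2 - sampleMean n x.1) *
    φ (sampleVar n x.1, sampleVar n x.2)

/-- The squared-error risk of the estimator determined by `φ` at `θ = (μ, v₁, v₂)`. -/
noncomputable def risk (n : ℕ) (μ v₁ v₂ : ℝ) (φ : ℝ × ℝ → ℝ) : ℝ :=
  ∫ x, (estimatorOf n φ x - μ) ^ 2 ∂(sampleLaw n μ v₁ v₂)

/-- The Graybill–Deal weight function `s₁ / (s₁ + s₂)`. -/
noncomputable def gdWeight (s : ℝ × ℝ) : ℝ := s.1 / (s.1 + s.2)


lemma gd_lintegral_pi_prod : ∀ {m : ℕ} (ν : Fin m → Measure ℝ) [∀ i, SigmaFinite (ν i)]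
    (f : Fin m → ℝ → ENNReal), (∀ i, Measurable (f i)) →
    ∫⁻ x, ∏ i, f i (x i) ∂(Measure.pi ν) = ∏ i, ∫⁻ x, f i x ∂(ν i) := by
  intro m
  induction m with
  | zero => intro ν _ f hf; simp
  | succ n ih =>
    intro ν _ f hf
    rw [← ((measurePreserving_piFinSuccAbove ν 0).symm).lintegral_comp_emb
      (MeasurableEquiv.measurableEmbedding _)]
    simp_rw [MeasurableEquiv.piFinSuccAbove_symm_apply, Fin.insertNthEquiv,
            Fin.prod_univ_succ, Fin.insertNth_zero, Equiv.coe_fn_mk, Fin.cons_succ,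
            Fin.zero_succAbove, Fin.cons_zero]
    have hm : Measurable (fun x : Fin n → ℝ => ∏ i : Fin n, f (Fin.succ i) (x i)) := by
      refine Finset.measurable_fun_prod _ fun i _ => (hf _).comp (measurable_pi_apply i)
    rw [← ih _ _ (fun i => hf _)]
    exact lintegral_prod_mul (hf 0).aemeasurable hm.aemeasurable

lemma gd_pi_gaussian (m : ℕ) (v : NNReal) (hv : v ≠ 0) :
    (Measure.pi fun _ : Fin m => gaussianReal 0 v) =
      (volume : Measure (Fin m → ℝ)).withDensity (fun u => ∏ i, gaussianPDF 0 v (u i)) := by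
  refine Measure.pi_eq fun s hs => ?_
  rw [withDensity_apply _ (MeasurableSet.univ_pi hs), volume_pi, Measure.restrict_pi_pi,
    gd_lintegral_pi_prod _ _ (fun _ => measurable_gaussianPDF 0 v)]
  refine Finset.prod_congr rfl fun i _ => ?_
  rw [gaussianReal_of_var_ne_zero _ hv, withDensity_apply _ (hs i)]

lemma gd_law (m : ℕ) (μ : ℝ) (v : NNReal) :
    Measure.map (fun x => (sampleMean (m+1) x, sampleVar (m+1) x))
      (Measure.pi fun _ : Fin (m+1) => gaussianReal μ v) =
    Measure.map (fun p : ℝ × (Fin m → ℝ) => (μ + p.1, (∑ i, (p.2 i)^2) / m))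
      ((gaussianReal 0 (v / (m+1))).prod (Measure.pi fun _ : Fin m => gaussianReal 0 v)) := by
  have hpos : (0:ℝ) < (m+1 : ℝ) := by positivity
  let e : EuclideanSpace ℝ (Fin (m+1)) := WithLp.toLp 2 (fun _ => 1 / √(m+1 : ℝ))
  have he : ‖e‖ = 1 := by
    have h0 : ‖e‖^2 = 1 := by
      rw [EuclideanSpace.real_norm_sq_eq]
      simp [e, Real.sq_sqrt hpos.le]
      field_simp
    nlinarith [norm_nonneg e]
  obtain ⟨b, hb⟩ : ∃ b : OrthonormalBasis (Fin (m+1)) ℝ (EuclideanSpace ℝ (Fin (m+1))), b 0 = e := by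
    obtain ⟨b, hb⟩ := Orthonormal.exists_orthonormalBasis_extension_of_card_eq (𝕜 := ℝ) (E := EuclideanSpace ℝ (Fin (m+1)))
      (ι := Fin (m+1)) (by simp) (v := fun _ => e) (s := {0})
      (by
        constructor
        · intro i; simpa using he
        · intro i j hij; exact absurd (Subsingleton.elim i j) hij)
    exact ⟨b, hb 0 rfl⟩
  have h1 : (Measure.pi fun _ : Fin (m+1) => gaussianReal μ v) =
      Measure.map (fun (y : Fin (m+1) → ℝ) j => μ + √v * (∑ i, y i • b i : EuclideanSpace ℝ (Fin (m+1))) j)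
        (Measure.pi fun _ : Fin (m+1) => gaussianReal 0 1) := by
    have hstd := stdGaussian_eq_map_pi_orthonormalBasis b
    rw [← map_pi_eq_stdGaussian] at hstd
    have hsc : (gaussianReal μ v) = Measure.map (fun t => μ + √v * t) (gaussianReal 0 1) := by
      have := gaussianReal_map_const_mul (μ := 0) (v := 1) (√(v:ℝ))
      rw [show (fun t => μ + √(v:ℝ) * t) = (fun t => μ + t) ∘ (fun t => √(v:ℝ) * t) from rfl,
        ← Measure.map_map (by fun_prop) (by fun_prop), this, gaussianReal_map_const_add]
      congr 1
      · simp
      · ext; simp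
    rw [hsc, ← Measure.pi_map_pi (μ := fun _ : Fin (m+1) => gaussianReal 0 1)
      (f := fun _ t => μ + √v * t) (fun i => by fun_prop)]
    have : (fun (y : Fin (m+1) → ℝ) (j : Fin (m+1)) => μ + √v * (∑ i, y i • b i : EuclideanSpace ℝ (Fin (m+1))) j)
      = (fun (x : EuclideanSpace ℝ (Fin (m+1))) (j : Fin (m+1)) => μ + √v * x j) ∘ (fun y => ∑ i, y i • b i) := rfl
    rw [this, ← Measure.map_map (by fun_prop) (by fun_prop), ← hstd,
      Measure.map_map (by fun_prop) (by fun_prop)]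
    rfl
  have h2 : (Measure.pi fun _ : Fin (m+1) => gaussianReal 0 1) =
      Measure.map (fun p : ℝ × (Fin m → ℝ) => (Fin.cons p.1 p.2 : Fin (m+1) → ℝ))
       ((gaussianReal 0 1).prod (Measure.pi fun _ : Fin m => gaussianReal 0 1)) := by
    have := ((measurePreserving_piFinSuccAbove (fun _ : Fin (m+1) => gaussianReal 0 1) 0).symm).map_eq
    rw [← this]
    congr 1
    ext1 p
    simp [MeasurableEquiv.piFinSuccAbove_symm_apply, Fin.insertNthEquiv]
  have h3 : gaussianReal 0 (v / (m+1)) =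
      Measure.map (fun t => √(v / (m+1) : ℝ) * t) (gaussianReal 0 1) := by
    rw [gaussianReal_map_const_mul]
    congr 1
    · simp
    · ext; simp; rw [div_pow, Real.sq_sqrt (by positivity), Real.sq_sqrt (by positivity)]
  have h4 : (Measure.pi fun _ : Fin m => gaussianReal 0 v) =
      Measure.map (fun (u : Fin m → ℝ) i => √v * u i)
        (Measure.pi fun _ : Fin m => gaussianReal 0 1) := by
    rw [Measure.pi_map_pi (μ := fun _ : Fin m => gaussianReal 0 1)
      (f := fun _ t => √v * t) (fun i => by fun_prop)]
    congr 1
    ext1 i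
    rw [gaussianReal_map_const_mul]
    congr 1
    · simp
    · ext; simp
  have hms : Measurable (fun x : Fin (m+1) → ℝ => (sampleMean (m+1) x, sampleVar (m+1) x)) := by
    unfold sampleMean sampleVar sampleMean; fun_prop
  have hmc : Measurable (fun p : ℝ × (Fin m → ℝ) => (Fin.cons p.1 p.2 : Fin (m+1) → ℝ)) := by
    refine measurable_pi_lambda _ fun i => ?_
    refine Fin.cases ?_ (fun i => ?_) i
    · simpa using measurable_fst
    · simp only [Fin.cons_succ]; fun_prop
  have hmb : Measurable (fun (y : Fin (m+1) → ℝ) j => μ + √v * (∑ i, y i • b i : EuclideanSpace ℝ (Fin (m+1))) j) := by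
    fun_prop
  rw [h1, h2, h3, h4, Measure.map_prod_map _ _ (by fun_prop) (by fun_prop),
    Measure.map_map hmb hmc, Measure.map_map hms (hmb.comp hmc),
    Measure.map_map (by fun_prop) (by fun_prop)]
  congr 1
  ext1 ⟨z, u⟩
  simp only [Function.comp_apply, Prod.map]
  set y : Fin (m+1) → ℝ := Fin.cons z u with hy
  set Y : EuclideanSpace ℝ (Fin (m+1)) := ∑ i, y i • b i with hY
  have hr : b.repr Y = WithLp.toLp 2 y := by
    rw [hY]
    ext j
    simp [Pi.single_apply]
  have hn : ∑ j, Y j ^ 2 = z^2 + ∑ i, u i ^ 2 := by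
    have := b.repr.norm_map Y
    have h5 : ‖b.repr Y‖^2 = ‖Y‖^2 := by rw [this]
    rw [hr, EuclideanSpace.real_norm_sq_eq, EuclideanSpace.real_norm_sq_eq, Fin.sum_univ_succ] at h5
    simpa [hy] using h5.symm
  have hsm : ∑ j, Y j = √(m+1:ℝ) * z := by
    have h5 : inner ℝ (b 0) Y = z := by
      rw [← b.repr_apply_apply, hr]; simp [hy]
    rw [hb] at h5
    have h6 : ∀ w : EuclideanSpace ℝ (Fin (m+1)), inner ℝ e w = ∑ j, w j * (√(m+1:ℝ))⁻¹ := by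
      intro w
      simp [e, PiLp.inner_apply]
    rw [h6, ← Finset.sum_mul] at h5
    rw [← h5]
    field_simp
  have hM : sampleMean (m+1) (fun j => μ + √v * Y j) = μ + √(v/(m+1):ℝ) * z := by
    unfold sampleMean
    rw [Finset.sum_add_distrib, ← Finset.mul_sum, hsm, Real.sqrt_div (by positivity)]
    have := Real.sq_sqrt hpos.le
    simp
    field_simp
    linear_combination (√v * z) * this
  ext1
  · exact hM
  · simp only
    unfold sampleVar
    rw [hM]
    have : ∀ j, (μ + √v * Y j - (μ + √(v/(m+1):ℝ) * z))^2 =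
      v * Y j^2 - (2 * √v * √(v/(m+1):ℝ) * z) * Y j + (v/(m+1)) * z^2 := by
      intro j
      have e1 := Real.sq_sqrt (show (0:ℝ) ≤ v by positivity)
      have e2 := Real.sq_sqrt (show (0:ℝ) ≤ v/(m+1) by positivity)
      linear_combination (Y j)^2 * e1 + z^2 * e2
    simp_rw [this]
    rw [Finset.sum_add_distrib, Finset.sum_sub_distrib, ← Finset.mul_sum, ← Finset.mul_sum, hn, hsm]
    have e3 : ∀ i, (√(v:ℝ) * u i)^2 = v * u i^2 := by
      intro i; rw [mul_pow, Real.sq_sqrt (by positivity)]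
    simp_rw [e3]
    rw [← Finset.mul_sum, Real.sqrt_div (by positivity)]
    have e1 := Real.sq_sqrt (show (0:ℝ) ≤ v by positivity)
    simp
    congr 1
    field_simp
    rw [e1, ← Finset.mul_sum]; ring

lemma gd_second_moment (σ : NNReal) (c b k : ℝ) (hk : 0 ≤ k) :
    ∫⁻ z, ENNReal.ofReal ((c + b * z)^2 + k) ∂(gaussianReal 0 σ) =
      ENNReal.ofReal (c^2 + b^2 * σ + k) := by
  have hm : MemLp id 2 (gaussianReal 0 σ) := memLp_id_gaussianReal' 2 (by simp)
  have i1 : Integrable (fun z : ℝ => z) (gaussianReal 0 σ) := hm.integrable (by norm_num)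
  have i2 : Integrable (fun z : ℝ => z^2) (gaussianReal 0 σ) := hm.integrable_sq
  have hv : ∫ z, z^2 ∂(gaussianReal 0 σ) = σ := by
    have := variance_id_gaussianReal (μ := 0) (v := σ)
    rw [variance_eq_sub hm] at this
    simpa using this
  have e : (fun z : ℝ => (c + b * z)^2 + k) = fun z => (c^2 + k) + ((2*c*b) * z + b^2 * z^2) := by
    ext z; ring
  have i3 : Integrable (fun z : ℝ => (2*c*b) * z + b^2 * z^2) (gaussianReal 0 σ) :=
    (i1.const_mul _).add (i2.const_mul _)
  have i4 : Integrable (fun z : ℝ => (c + b * z)^2 + k) (gaussianReal 0 σ) := by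
    rw [e]; exact (integrable_const _).add i3
  rw [← ofReal_integral_eq_lintegral_ofReal i4 (Filter.Eventually.of_forall fun z => by positivity)]
  congr 1
  rw [e, integral_add (integrable_const _) i3, integral_add (i1.const_mul _) (i2.const_mul _),
    integral_const_mul, integral_const_mul, hv, integral_id_gaussianReal]
  simp
  ring

lemma gd_lintegral_rearrange {U : Type*} [MeasurableSpace U] (N₁ N₂ : Measure ℝ)
    (γ₁ γ₂ : Measure U) [SFinite N₁] [SFinite N₂] [SFinite γ₁] [SFinite γ₂]
    (F : (ℝ × U) × (ℝ × U) → ENNReal) (hF : Measurable F) :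
    (Measurable fun p : U × U => ∫⁻ z₁, ∫⁻ z₂, F ((z₁, p.1), (z₂, p.2)) ∂N₂ ∂N₁) ∧
    ∫⁻ q, F q ∂((N₁.prod γ₁).prod (N₂.prod γ₂)) =
      ∫⁻ p, ∫⁻ z₁, ∫⁻ z₂, F ((z₁, p.1), (z₂, p.2)) ∂N₂ ∂N₁ ∂(γ₁.prod γ₂) := by
  have hG : Measurable (fun r : (U × U) × (ℝ × ℝ) => F ((r.2.1, r.1.1), (r.2.2, r.1.2))) := by
    fun_prop
  have hH : Measurable (fun r : ((U × U) × ℝ) => ∫⁻ z₂, F ((r.2, r.1.1), (z₂, r.1.2)) ∂N₂) := by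
    have : Measurable (fun r : ((U × U) × ℝ) × ℝ => F ((r.1.2, r.1.1.1), (r.2, r.1.1.2))) := by
      fun_prop
    exact this.lintegral_prod_right'
  refine ⟨hH.lintegral_prod_right', ?_⟩
  rw [lintegral_prod _ hF.aemeasurable, lintegral_prod_symm' _ hF.lintegral_prod_right',
    lintegral_prod _ (Measurable.aemeasurable hH.lintegral_prod_right')]
  refine lintegral_congr fun u₁ => ?_
  symm
  rw [lintegral_lintegral_swap]
  · refine lintegral_congr fun z₁ => ?_
    exact (lintegral_prod_symm' (fun y => F ((z₁, u₁), y)) (hF.comp measurable_prodMk_left)).symm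
  · have : Measurable (fun r : U × ℝ => ((u₁, r.1), r.2)) := by fun_prop
    exact (hH.comp this).aemeasurable

lemma gd_gaussianPDF_prod (m : ℕ) (v : ℝ) (hv : 0 < v) (u : Fin m → ℝ) :
    ∏ i, gaussianPDF 0 v.toNNReal (u i) =
      ENNReal.ofReal ((√(2 * Real.pi * v))⁻¹ ^ m * Real.exp (-((∑ i, u i ^2) / v) / 2)) := by
  simp_rw [gaussianPDF]
  rw [← ENNReal.ofReal_prod_of_nonneg (fun i _ => gaussianPDFReal_nonneg _ _ _)]
  congr 1
  simp_rw [gaussianPDFReal]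
  rw [Finset.prod_mul_distrib, ← Real.exp_sum]
  have e : ∑ i, -(u i - 0)^2 / (2 * v) = -((∑ i, u i ^2) / v) / 2 := by
    rw [Finset.sum_div, ← Finset.sum_neg_distrib, Finset.sum_div]
    refine Finset.sum_congr rfl fun i _ => ?_
    field_simp
    ring
  rw [Real.coe_toNNReal v hv.le, e]
  simp

/-- Normalised quadratic form coordinates. -/
noncomputable def gdS (m : ℕ) (p : (Fin m → ℝ) × (Fin m → ℝ)) : ℝ × ℝ :=
  ((∑ i, (p.1 i)^2) / m, (∑ i, (p.2 i)^2) / m)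

lemma gd_measurable_S (m : ℕ) : Measurable (gdS m) := by
  unfold gdS; fun_prop

lemma gd_risk_formula (m : ℕ) (μ v₁ v₂ : ℝ) (h₁ : 0 < v₁) (h₂ : 0 < v₂) :
    ∃ C : ℝ, 0 < C ∧ ∀ φ : ℝ × ℝ → ℝ, Measurable φ →
      risk (m+1) μ v₁ v₂ φ = C * ∫ p : (Fin m → ℝ) × (Fin m → ℝ),
        ((1 - φ (gdS m p))^2 * v₁ + (φ (gdS m p))^2 * v₂) *
          Real.exp (-((∑ i, (p.1 i)^2) / v₁ + (∑ i, (p.2 i)^2) / v₂) / 2) := by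
  refine ⟨(√(2 * Real.pi * v₁))⁻¹ ^ m * (√(2 * Real.pi * v₂))⁻¹ ^ m / (m+1), by positivity, ?_⟩
  intro φ hφ
  have hms : Measurable (fun x : Fin (m+1) → ℝ => (sampleMean (m+1) x, sampleVar (m+1) x)) := by
    unfold sampleMean sampleVar sampleMean; fun_prop
  have hS := gd_measurable_S m
  let H : (ℝ × ℝ) × (ℝ × ℝ) → ENNReal := fun r =>
    ENNReal.ofReal ((r.1.1 + (r.2.1 - r.1.1) * φ (r.1.2, r.2.2) - μ)^2)
  have hH : Measurable H := by
    have : Measurable (fun r : (ℝ × ℝ) × (ℝ × ℝ) => φ (r.1.2, r.2.2)) := hφ.comp (by fun_prop)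
    refine ENNReal.measurable_ofReal.comp ?_
    fun_prop
  have hmE : Measurable (estimatorOf (m+1) φ) := by
    have h5 : Measurable (fun x : (Fin (m+1) → ℝ) × (Fin (m+1) → ℝ) =>
      φ (sampleVar (m+1) x.1, sampleVar (m+1) x.2)) :=
      hφ.comp ((hms.snd.comp measurable_fst).prodMk (hms.snd.comp measurable_snd))
    exact (hms.fst.comp measurable_fst).add
      (((hms.fst.comp measurable_snd).sub (hms.fst.comp measurable_fst)).mul h5)
  let G : (ℝ × (Fin m → ℝ)) → ℝ × ℝ := fun p => (μ + p.1, (∑ i, (p.2 i)^2) / m)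
  have hG : Measurable G := by fun_prop
  unfold risk
  rw [integral_eq_lintegral_of_nonneg_ae (Filter.Eventually.of_forall fun x => by positivity)
    (by fun_prop)]
  have e1 : ∫⁻ x, ENNReal.ofReal ((estimatorOf (m+1) φ x - μ)^2) ∂(sampleLaw (m+1) μ v₁ v₂) =
      ∫⁻ q, H (Prod.map G G q) ∂(((gaussianReal 0 (v₁.toNNReal / (m+1))).prod
        (Measure.pi fun _ : Fin m => gaussianReal 0 v₁.toNNReal)).prod
          ((gaussianReal 0 (v₂.toNNReal / (m+1))).prod
        (Measure.pi fun _ : Fin m => gaussianReal 0 v₂.toNNReal))) := by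
    rw [← lintegral_map hH (hG.prodMap hG), ← Measure.map_prod_map _ _ hG hG, ← gd_law, ← gd_law,
      Measure.map_prod_map _ _ hms hms, lintegral_map hH (hms.prodMap hms)]
    rfl
  have hd : ∀ v : ℝ, Measurable (fun u : Fin m → ℝ => ∏ i, gaussianPDF 0 v.toNNReal (u i)) :=
    fun v => Finset.measurable_fun_prod _
      fun i _ => (measurable_gaussianPDF 0 _).comp (measurable_pi_apply i)
  obtain ⟨hmm, hre⟩ := gd_lintegral_rearrange (gaussianReal 0 (v₁.toNNReal / (m+1)))
    (gaussianReal 0 (v₂.toNNReal / (m+1))) (Measure.pi fun _ : Fin m => gaussianReal 0 v₁.toNNReal)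
    (Measure.pi fun _ : Fin m => gaussianReal 0 v₂.toNNReal) (fun q => H (Prod.map G G q))
    (hH.comp (hG.prodMap hG))
  rw [e1, hre, ← integral_const_mul,
    integral_eq_lintegral_of_nonneg_ae (Filter.Eventually.of_forall fun x => by positivity)
    (by fun_prop), gd_pi_gaussian _ _ (by simpa using h₁), gd_pi_gaussian _ _ (by simpa using h₂),
    prod_withDensity (hd _) (hd _), lintegral_withDensity_eq_lintegral_mul₀]
  · congr 1
    refine lintegral_congr fun p => ?_
    simp only [Pi.mul_apply]
    rw [gd_gaussianPDF_prod _ _ h₁, gd_gaussianPDF_prod _ _ h₂]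
    have e2 : ∀ z₁ z₂ : ℝ, H (Prod.map G G ((z₁, p.1), (z₂, p.2))) =
        ENNReal.ofReal (((1 - φ (gdS m p)) * z₁ + φ (gdS m p) * z₂)^2 + 0) := by
      intro z₁ z₂
      simp only [H, G, Prod.map, gdS]
      congr 1
      ring
    simp_rw [e2]
    simp_rw [gd_second_moment _ _ _ 0 le_rfl]
    have e3 : ∀ z₁ : ℝ, ((1 - φ (gdS m p)) * z₁) ^ 2 +
        φ (gdS m p) ^ 2 * ((v₂.toNNReal / (m+1) : NNReal) : ℝ) + 0 =
        (0 + (1 - φ (gdS m p)) * z₁) ^ 2 + φ (gdS m p) ^ 2 * ((v₂.toNNReal / (m+1) : NNReal) : ℝ) := by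
      intro z; ring
    simp_rw [e3]
    rw [gd_second_moment _ _ _ _ (by positivity), ← ENNReal.ofReal_mul (by positivity),
      ← ENNReal.ofReal_mul (by positivity)]
    congr 1
    have e4 : -((∑ i, (p.1 i)^2) / v₁ + (∑ i, (p.2 i)^2) / v₂) / 2 =
      -((∑ i, (p.1 i)^2) / v₁) / 2 + -((∑ i, (p.2 i)^2) / v₂) / 2 := by ring
    rw [e4, Real.exp_add]
    have e5 : ∀ v : ℝ, 0 < v → ((v.toNNReal / (m+1) : NNReal) : ℝ) = v / (m+1) := by
      intro v hv; simp [hv.le]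
    rw [e5 _ h₁, e5 _ h₂]
    ring
  · exact (((hd _).comp measurable_fst).mul ((hd _).comp measurable_snd)).aemeasurable
  · exact hmm.aemeasurable

/-- The exponential kernel. -/
noncomputable def gdE (s t x : ℝ) : ℝ :=
  Real.exp (-(Real.exp x * s + Real.exp (-x) * t) / 2)

lemma gdE_pos (s t x : ℝ) : 0 < gdE s t x := Real.exp_pos _

lemma gdE_swap (s t x : ℝ) : gdE s t (-x) = gdE t s x := by
  unfold gdE; rw [neg_neg, add_comm]

lemma gdE_hasDerivAt (s t x : ℝ) :
    HasDerivAt (gdE s t) (-((Real.exp x * s - Real.exp (-x) * t) / 2) * gdE s t x) x := by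
  have h1 : HasDerivAt (fun x => Real.exp (-x)) (-Real.exp (-x)) x := by
    simpa using (hasDerivAt_neg x).exp
  have h2 := ((((Real.hasDerivAt_exp x).mul_const s).add (h1.mul_const t)).neg.div_const 2).exp
  refine h2.congr_deriv ?_
  simp only [gdE, Pi.add_apply, Pi.neg_apply]
  ring

lemma gd_tail (s t K : ℝ) (hs : 0 < s) (ht : 0 < t) :
    ENNReal.ofReal (2 / s * gdE s t K) ≤
      ∫⁻ x in Set.Ioi K, ENNReal.ofReal (Real.exp x * gdE s t x) := by
  let F : ℝ → ℝ := fun x => -(2 / s) * Real.exp (-(Real.exp x * s) / 2) * Real.exp (-(Real.exp (-K) * t) / 2)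
  let f : ℝ → ℝ := fun x => Real.exp x * Real.exp (-(Real.exp x * s) / 2) * Real.exp (-(Real.exp (-K) * t) / 2)
  have hd : ∀ x, HasDerivAt F (f x) x := by
    intro x
    have := ((((((Real.hasDerivAt_exp x).mul_const s).neg.div_const 2).exp).const_mul
      (-(2 / s))).mul_const (Real.exp (-(Real.exp (-K) * t) / 2)))
    refine this.congr_deriv ?_
    simp only [f, Pi.neg_apply]
    field_simp
  have hlim : Filter.Tendsto F Filter.atTop (nhds 0) := by
    have h1 : Filter.Tendsto (fun x => Real.exp (-(Real.exp x * s) / 2)) Filter.atTop (nhds 0) := by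
      refine Real.tendsto_exp_atBot.comp ?_
      have : Filter.Tendsto (fun x => Real.exp x * (s/2)) Filter.atTop Filter.atTop :=
        Real.tendsto_exp_atTop.atTop_mul_const (by positivity)
      refine (Filter.tendsto_neg_atTop_atBot.comp this).congr fun x => ?_
      simp only [Function.comp_apply]; ring
    have h2 := (h1.const_mul (-(2/s))).mul_const (Real.exp (-(Real.exp (-K) * t) / 2))
    simpa [F] using h2
  have hf0 : ∀ x ∈ Set.Ioi K, 0 ≤ f x := fun x _ => by positivity
  have hIntg : IntegrableOn f (Set.Ioi K) :=
    integrableOn_Ioi_deriv_of_nonneg' (fun x _ => hd x) hf0 hlim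
  have hval : ∫ x in Set.Ioi K, f x = 2 / s * gdE s t K := by
    rw [integral_Ioi_of_hasDerivAt_of_nonneg' (fun x _ => hd x) hf0 hlim]
    simp only [F, gdE]
    rw [neg_add, add_div, Real.exp_add]
    ring
  rw [← hval, ofReal_integral_eq_lintegral_ofReal hIntg
    ((ae_restrict_iff' measurableSet_Ioi).2 (Filter.Eventually.of_forall hf0))]
  refine setLIntegral_mono' measurableSet_Ioi fun x hx => ENNReal.ofReal_le_ofReal ?_
  simp only [f, gdE]
  rw [mul_assoc, ← Real.exp_add]
  have hx' : Real.exp (-x) ≤ Real.exp (-K) := Real.exp_le_exp.2 (by simpa using (le_of_lt hx))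
  refine mul_le_mul_of_nonneg_left (Real.exp_le_exp.2 ?_) (Real.exp_pos x).le
  nlinarith

lemma gd_D_mono (s t K : ℝ) (hst : s ≤ t) (hK : 0 ≤ K) : gdE s t (-K) ≤ gdE s t K := by
  unfold gdE
  refine Real.exp_le_exp.2 ?_
  have : Real.exp (-K) ≤ Real.exp K := Real.exp_le_exp.2 (by linarith)
  rw [neg_neg]
  nlinarith

lemma gd_tail_D_aux (s t K : ℝ) (hs : 0 < s) (hst : s ≤ t) (hK : 0 ≤ K) :
    ENNReal.ofReal (|gdE s t K - gdE s t (-K)| * (1 / s + 1 / t)) ≤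
      ∫⁻ x in Set.Ioi K, ENNReal.ofReal ((Real.exp (-x) + Real.exp x) * gdE s t x) := by
  have ht : 0 < t := lt_of_lt_of_le hs hst
  calc _ ≤ ENNReal.ofReal (2 / s * gdE s t K) := by
        refine ENNReal.ofReal_le_ofReal ?_
        rw [abs_of_nonneg (sub_nonneg.2 (gd_D_mono s t K hst hK))]
        have h1 : 1 / t ≤ 1 / s := one_div_le_one_div_of_le hs hst
        have h2 : 1 / s + 1 / t ≤ 2 / s := by
          calc _ ≤ 1 / s + 1 / s := by linarith
            _ = 2 / s := by ring
        rw [mul_comm]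
        have := gdE_pos s t (-K)
        have := gdE_pos s t K
        refine mul_le_mul h2 (by linarith) (sub_nonneg.2 (gd_D_mono s t K hst hK)) (by positivity)
    _ ≤ _ := gd_tail s t K hs ht
    _ ≤ _ := by
        refine setLIntegral_mono' measurableSet_Ioi fun x hx => ENNReal.ofReal_le_ofReal ?_
        refine mul_le_mul_of_nonneg_right ?_ (gdE_pos _ _ _).le
        linarith [Real.exp_pos (-x)]

lemma gd_tail_D (s t K : ℝ) (hs : 0 < s) (ht : 0 < t) (hK : 0 ≤ K) :
    ENNReal.ofReal (|gdE s t K - gdE s t (-K)| * (1 / s + 1 / t)) ≤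
      ∫⁻ x in (Set.Ioc (-K) K)ᶜ, ENNReal.ofReal ((Real.exp (-x) + Real.exp x) * gdE s t x) := by
  rcases le_total s t with h | h
  · refine (gd_tail_D_aux s t K hs h hK).trans (lintegral_mono_set ?_)
    intro x hx hx'
    exact absurd hx'.2 (not_le.2 hx)
  · have h1 := gd_tail_D_aux t s K ht h hK
    rw [← gdE_swap s t, ← gdE_swap s t, neg_neg, abs_sub_comm, add_comm (1/t)] at h1
    refine h1.trans ?_
    have h2 := (Measure.measurePreserving_neg (volume : Measure ℝ)).setLIntegral_comp_preimage_emb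
      (MeasurableEquiv.neg ℝ).measurableEmbedding
      (fun x => ENNReal.ofReal ((Real.exp (-x) + Real.exp x) * gdE s t x)) (Set.Iio (-K))
    have h3 : (Neg.neg ⁻¹' Set.Iio (-K) : Set ℝ) = Set.Ioi K := by ext; simp
    rw [h3] at h2
    calc _ = ∫⁻ x in Set.Ioi K, ENNReal.ofReal ((Real.exp (- -x) + Real.exp (-x)) * gdE s t (-x)) := by
          refine lintegral_congr fun x => ?_
          rw [gdE_swap s t, neg_neg, add_comm (Real.exp x)]
      _ = _ := h2
      _ ≤ _ := by
          refine lintegral_mono_set ?_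
          intro x hx hx'
          exact absurd hx'.1 (not_lt.2 (le_of_lt hx))

lemma gd_D_path (s t K : ℝ) (hs : 0 ≤ s) (ht : 0 ≤ t) (hK : 0 ≤ K) :
    ENNReal.ofReal (|gdE s t K - gdE s t (-K)| / (s + t)) ≤
      ∫⁻ a in Set.Ioc (-(Real.pi/2)) (Real.pi/2), ENNReal.ofReal (Real.sinh K * Real.cos a *
        Real.exp (-((Real.cosh K + Real.sinh K * Real.sin a) * s +
          (Real.cosh K - Real.sinh K * Real.sin a) * t) / 2)) := by
  let f : ℝ → ℝ := fun a => Real.exp (-((Real.cosh K + Real.sinh K * Real.sin a) * s +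
          (Real.cosh K - Real.sinh K * Real.sin a) * t) / 2)
  let f' : ℝ → ℝ := fun a => f a * (-(Real.sinh K * Real.cos a * (s - t)) / 2)
  have hd : ∀ a, HasDerivAt f (f' a) a := by
    intro a
    have h1 := (Real.hasDerivAt_sin a).const_mul (Real.sinh K)
    have h2 := ((((h1.const_add (Real.cosh K)).mul_const s).add
      ((h1.const_sub (Real.cosh K)).mul_const t)).neg.div_const 2).exp
    refine h2.congr_deriv ?_
    simp only [f, f', Pi.add_apply, Pi.neg_apply]
    ring
  have hc : Continuous f' := by fun_prop
  have hpi : -(Real.pi/2) ≤ Real.pi/2 := by linarith [Real.pi_pos]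
  have hI : ∫ a in (-(Real.pi/2))..(Real.pi/2), f' a = gdE s t K - gdE s t (-K) := by
    rw [intervalIntegral.integral_eq_sub_of_hasDerivAt (fun a _ => hd a) (hc.intervalIntegrable _ _)]
    simp only [f, gdE, Real.sin_neg, Real.sin_pi_div_two, neg_neg, mul_neg, mul_one]
    rw [Real.cosh_add_sinh, ← sub_eq_add_neg, Real.cosh_sub_sinh, sub_neg_eq_add, Real.cosh_add_sinh]
  have hsinh : 0 ≤ Real.sinh K := Real.sinh_nonneg_iff.2 hK
  let g : ℝ → ℝ := fun a => Real.sinh K * Real.cos a * f a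
  have hgc : Continuous g := by fun_prop
  have hcos : ∀ a ∈ Set.Ioc (-(Real.pi/2)) (Real.pi/2), 0 ≤ Real.cos a := fun a ha =>
    Real.cos_nonneg_of_mem_Icc ⟨ha.1.le, ha.2⟩
  have hg0 : ∀ a ∈ Set.Ioc (-(Real.pi/2)) (Real.pi/2), 0 ≤ g a := fun a ha =>
    mul_nonneg (mul_nonneg hsinh (hcos a ha)) (Real.exp_pos _).le
  have hbound : |gdE s t K - gdE s t (-K)| ≤ (s + t) * ∫ a in (-(Real.pi/2))..(Real.pi/2), g a := by
    rw [← hI, ← intervalIntegral.integral_const_mul, ← Real.norm_eq_abs]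
    refine intervalIntegral.norm_integral_le_of_norm_le hpi ?_ ((hgc.const_mul _).intervalIntegrable _ _)
    refine Filter.Eventually.of_forall fun a ha => ?_
    simp only [f', g, norm_mul, norm_div, norm_neg, Real.norm_eq_abs]
    rw [abs_of_nonneg hsinh, abs_of_nonneg (hcos a ha), abs_of_pos (Real.exp_pos _)]
    have h3 : |s - t| ≤ s + t := abs_le.2 ⟨by linarith, by linarith⟩
    have h4 := hg0 a ha
    simp only [g] at h4
    rw [abs_of_pos (by norm_num : (0:ℝ) < 2)]
    nlinarith [mul_le_mul_of_nonneg_left h3 h4, mul_nonneg h4 (add_nonneg hs ht)]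
  have hle : |gdE s t K - gdE s t (-K)| / (s + t) ≤ ∫ a in (-(Real.pi/2))..(Real.pi/2), g a := by
    rcases (add_nonneg hs ht).eq_or_lt with h | h
    · rw [← h, div_zero]
      rw [intervalIntegral.integral_of_le hpi]
      exact setIntegral_nonneg measurableSet_Ioc hg0
    · rw [div_le_iff₀ h]; linarith
  refine (ENNReal.ofReal_le_ofReal hle).trans ?_
  rw [intervalIntegral.integral_of_le hpi, ofReal_integral_eq_lintegral_ofReal
    (hgc.integrableOn_Ioc)
    ((ae_restrict_iff' measurableSet_Ioc).2 (Filter.Eventually.of_forall hg0))]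

lemma gd_limit (ρ : Measure ℝ) (C : ENNReal) (hC : C ≠ ⊤)
    (h1 : ∀ k : ℕ, ρ (Set.Ioc (-(k:ℝ)) k) ≤ 4 * C)
    (h2 : ∀ k : ℕ, ∀ ε : ℝ, 0 < ε → ρ (Set.Ioc (-(k:ℝ)) k) ≤
      ENNReal.ofReal (2 / ε) * ρ (Set.Ioc (-(k:ℝ)) k)ᶜ + ENNReal.ofReal (2 * ε) * C) :
    ρ Set.univ = 0 := by
  have hmono : Monotone (fun k : ℕ => Set.Ioc (-(k:ℝ)) k) := by
    intro a b hab
    have : (a:ℝ) ≤ b := by exact_mod_cast hab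
    exact Set.Ioc_subset_Ioc (by linarith) this
  have hU : (⋃ k : ℕ, Set.Ioc (-(k:ℝ)) k) = Set.univ := by
    refine Set.eq_univ_of_forall fun x => Set.mem_iUnion.2 ?_
    obtain ⟨k, hk⟩ := exists_nat_gt |x|
    exact ⟨k, (abs_lt.1 hk).1, (abs_lt.1 hk).2.le⟩
  have ht := tendsto_measure_iUnion_atTop (μ := ρ) hmono
  rw [hU] at ht
  have hfin : ρ Set.univ ≠ ⊤ := by
    have : ρ Set.univ ≤ 4 * C := le_of_tendsto' ht h1
    exact ne_top_of_le_ne_top (ENNReal.mul_ne_top (by norm_num) hC) this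
  have : IsFiniteMeasure ρ := ⟨hfin.lt_top⟩
  have htc : Filter.Tendsto (fun k : ℕ => ρ (Set.Ioc (-(k:ℝ)) k)ᶜ) Filter.atTop (nhds 0) := by
    have h3 := ENNReal.Tendsto.sub (tendsto_const_nhds (x := ρ Set.univ)) ht (Or.inl hfin)
    rw [tsub_self] at h3
    refine h3.congr fun k => ?_
    exact (measure_compl measurableSet_Ioc (measure_ne_top _ _)).symm
  have h4 : ∀ ε : ℝ, 0 < ε → ρ Set.univ ≤ ENNReal.ofReal (2 * ε) * C := by
    intro ε hε
    have h5 := (ENNReal.Tendsto.const_mul htc (a := ENNReal.ofReal (2/ε)) (Or.inr (by simp))).add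
      (tendsto_const_nhds (x := ENNReal.ofReal (2 * ε) * C))
    rw [mul_zero, zero_add] at h5
    exact le_of_tendsto_of_tendsto' ht h5 (fun k => h2 k ε hε)
  have h6 : Filter.Tendsto (fun k : ℕ => ENNReal.ofReal (2 * (1 / ((k:ℝ) + 1))) * C) Filter.atTop
      (nhds 0) := by
    have h7 : Filter.Tendsto (fun k : ℕ => ENNReal.ofReal (2 * (1 / ((k:ℝ) + 1)))) Filter.atTop
      (nhds 0) := by
      have := ENNReal.tendsto_ofReal (tendsto_one_div_add_atTop_nhds_zero_nat.const_mul (2:ℝ))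
      simpa using this
    simpa using ENNReal.Tendsto.mul_const h7 (Or.inr hC)
  exact le_antisymm (ge_of_tendsto' h6 fun k => h4 _ (by positivity)) zero_le

lemma gd_aprime {Ω : Type*} [MeasurableSpace Ω] (lam : Measure Ω) [SFinite lam] (s t : Ω → ℝ)
    (hs : Measurable s) (ht : Measurable t) (hs0 : ∀ p, 0 ≤ s p) (ht0 : ∀ p, 0 ≤ t p)
    (B : ℝ) (hB0 : 0 ≤ B)
    (hB : ∀ c₁ c₂ : ℝ, 0 < c₁ → 0 < c₂ → 1 ≤ c₁ * c₂ →
      ∫⁻ p, ENNReal.ofReal (Real.exp (-(c₁ * s p + c₂ * t p) / 2)) ∂lam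
        ≤ ENNReal.ofReal (B / Real.sqrt (c₁ * c₂)))
    (K : ℝ) (hK : 0 ≤ K) :
    ∫⁻ p, ENNReal.ofReal (|gdE (s p) (t p) K - gdE (s p) (t p) (-K)| / (s p + t p)) ∂lam
      ≤ ENNReal.ofReal B * ENNReal.ofReal Real.pi := by
  have hsh : 0 ≤ Real.sinh K := Real.sinh_nonneg_iff.2 hK
  calc _ ≤ ∫⁻ p, (∫⁻ a in Set.Ioc (-(Real.pi/2)) (Real.pi/2),
        ENNReal.ofReal (Real.sinh K * Real.cos a *
          Real.exp (-((Real.cosh K + Real.sinh K * Real.sin a) * s p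
            + (Real.cosh K - Real.sinh K * Real.sin a) * t p) / 2))) ∂lam :=
        lintegral_mono fun p => gd_D_path _ _ K (hs0 p) (ht0 p) hK
    _ = ∫⁻ a in Set.Ioc (-(Real.pi/2)) (Real.pi/2), ∫⁻ p,
        ENNReal.ofReal (Real.sinh K * Real.cos a *
          Real.exp (-((Real.cosh K + Real.sinh K * Real.sin a) * s p
            + (Real.cosh K - Real.sinh K * Real.sin a) * t p) / 2)) ∂lam := by
        apply lintegral_lintegral_swap
        apply Measurable.aemeasurable
        unfold Function.uncurry
        fun_prop
    _ ≤ ∫⁻ a in Set.Ioc (-(Real.pi/2)) (Real.pi/2), ENNReal.ofReal B := by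
        apply setLIntegral_mono measurable_const
        intro a ha
        have hc : 0 ≤ Real.cos a := Real.cos_nonneg_of_mem_Icc ⟨ha.1.le, ha.2⟩
        have hlt : Real.sinh K < Real.cosh K := Real.sinh_lt_cosh K
        have hsin1 := Real.sin_le_one a
        have hsin2 := Real.neg_one_le_sin a
        have h1 : 0 < Real.cosh K + Real.sinh K * Real.sin a := by nlinarith
        have h2 : 0 < Real.cosh K - Real.sinh K * Real.sin a := by nlinarith
        have h3 : (Real.cosh K + Real.sinh K * Real.sin a) *
            (Real.cosh K - Real.sinh K * Real.sin a) = 1 + (Real.sinh K * Real.cos a)^2 := by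
          have e1 := Real.cosh_sq K
          have e2 := Real.sin_sq_add_cos_sq a
          have e3 : Real.sin a ^ 2 = 1 - Real.cos a ^ 2 := by linarith
          ring_nf
          rw [e1, e3]; ring
        have h4 := hB _ _ h1 h2 (by rw [h3]; nlinarith [sq_nonneg (Real.sinh K * Real.cos a)])
        have h0 : 0 ≤ Real.sinh K * Real.cos a := mul_nonneg hsh hc
        have h5 : Real.sinh K * Real.cos a ≤ Real.sqrt (1 + (Real.sinh K * Real.cos a)^2) :=
          Real.le_sqrt_of_sq_le (by linarith)
        have h6 : 0 < Real.sqrt (1 + (Real.sinh K * Real.cos a)^2) := by positivity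
        rw [h3] at h4
        simp_rw [ENNReal.ofReal_mul h0]
        rw [lintegral_const_mul _ (by fun_prop)]
        calc _ ≤ ENNReal.ofReal (Real.sinh K * Real.cos a) *
              ENNReal.ofReal (B / Real.sqrt (1 + (Real.sinh K * Real.cos a)^2)) := by
              rw [ENNReal.ofReal_mul hsh] at *
              gcongr
          _ ≤ _ := by
              rw [← ENNReal.ofReal_mul h0]
              apply ENNReal.ofReal_le_ofReal
              rw [mul_div_assoc', div_le_iff₀ h6]
              nlinarith
    _ = _ := by
        rw [setLIntegral_const, Real.volume_Ioc]
        congr 2; ring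

lemma gd_b {Ω : Type*} [MeasurableSpace Ω] (lam : Measure Ω) [SFinite lam] (s t d : Ω → ℝ)
    (hs : Measurable s) (ht : Measurable t) (hd : Measurable d)
    (hs0 : ∀ᵐ p ∂lam, 0 < s p) (ht0 : ∀ᵐ p ∂lam, 0 < t p) (K : ℝ) (hK : 0 ≤ K) :
    ∫⁻ p, ENNReal.ofReal ((d p)^2 * (|gdE (s p) (t p) K - gdE (s p) (t p) (-K)|
        * (1 / s p + 1 / t p))) ∂lam
      ≤ ∫⁻ x in (Set.Ioc (-K) K)ᶜ, ∫⁻ p, ENNReal.ofReal ((d p)^2 *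
        ((Real.exp (-x) + Real.exp x) * gdE (s p) (t p) x)) ∂lam := by
  have hmeas : Measurable (fun q : ℝ × Ω => ENNReal.ofReal ((d q.2)^2 *
        ((Real.exp (-q.1) + Real.exp q.1) * gdE (s q.2) (t q.2) q.1))) := by
    unfold gdE; fun_prop
  rw [lintegral_lintegral_swap hmeas.aemeasurable]
  apply lintegral_mono_ae
  filter_upwards [hs0, ht0] with p h1 h2
  simp_rw [ENNReal.ofReal_mul (sq_nonneg (d p))]
  rw [lintegral_const_mul _ (by unfold gdE; fun_prop)]
  gcongr
  exact gd_tail_D _ _ K h1 h2 hK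

lemma gd_amgm (s t d D ε : ℝ) (hs : 0 < s) (ht : 0 < t) (hε : 0 < ε) :
    4 * |d| * |D| / (s + t) ≤ 2 / ε * (d^2 * (|D| * (1/s+1/t))) + 2 * ε * (|D| / (s + t)) := by
  have hD := abs_nonneg D
  have hd := sq_abs d
  rw [← hd]
  have hst : 0 < s + t := by positivity
  have key : 4 * |d| / (s+t) ≤ 2 / ε * (|d|^2 * (1/s+1/t)) + 2 * ε / (s+t) := by
    have h1 : 1 / (s+t) ≤ 1/s + 1/t := by
      have : 1 / (s+t) ≤ 1/s := one_div_le_one_div_of_le hs (by linarith)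
      have : 0 < 1/t := by positivity
      linarith
    have h2 : 4 * |d| ≤ 2 / ε * |d|^2 + 2 * ε := by
      have : 2 / ε * |d|^2 + 2 * ε - 4 * |d| = 2 / ε * (|d| - ε)^2 := by field_simp; ring
      have : 0 ≤ 2 / ε * (|d| - ε)^2 := by positivity
      linarith
    have h3 : 0 < 1/(s+t) := by positivity
    calc _ = 4 * |d| * (1/(s+t)) := by ring
      _ ≤ (2 / ε * |d|^2 + 2 * ε) * (1/(s+t)) := by gcongr
      _ = 2 / ε * (|d|^2 * (1/(s+t))) + 2 * ε / (s+t) := by ring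
      _ ≤ _ := by gcongr
  calc _ = |D| * (4 * |d| / (s+t)) := by ring
    _ ≤ |D| * (2 / ε * (|d|^2 * (1/s+1/t)) + 2 * ε / (s+t)) := by gcongr
    _ = _ := by ring

lemma gd_c {Ω : Type*} [MeasurableSpace Ω] (lam : Measure Ω) [SFinite lam] (s t d : Ω → ℝ)
    (hs : Measurable s) (ht : Measurable t) (hd : Measurable d)
    (hs0 : ∀ᵐ p ∂lam, 0 < s p) (ht0 : ∀ᵐ p ∂lam, 0 < t p) (hd1 : ∀ p, |d p| ≤ 1)
    (hfin : ∀ c₁ c₂ : ℝ, 0 < c₁ → 0 < c₂ →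
      Integrable (fun p => Real.exp (-(c₁ * s p + c₂ * t p) / 2)) lam)
    (hdom : ∀ x : ℝ, ∫ p, (d p)^2 * ((Real.exp (-x) + Real.exp x) * gdE (s p) (t p) x) ∂lam
      ≤ ∫ p, 2 * d p * ((Real.exp x * s p - Real.exp (-x) * t p) / (s p + t p))
        * gdE (s p) (t p) x ∂lam)
    (K : ℝ) (hK : 0 ≤ K) :
    ∫⁻ x in Set.Ioc (-K) K, ∫⁻ p, ENNReal.ofReal ((d p)^2 *
        ((Real.exp (-x) + Real.exp x) * gdE (s p) (t p) x)) ∂lam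
      ≤ ∫⁻ p, ENNReal.ofReal (4 * |d p| * |gdE (s p) (t p) K - gdE (s p) (t p) (-K)|
        / (s p + t p)) ∂lam := by
  set M : ℝ → Ω → ℝ := fun x p =>
    2 * d p * ((Real.exp x * s p - Real.exp (-x) * t p) / (s p + t p)) * gdE (s p) (t p) x with hM
  have hMmeas : Measurable (Function.uncurry M) := by
    unfold Function.uncurry
    simp only [hM]
    unfold gdE; fun_prop
  have hbase : Integrable (fun p => Real.exp (-(Real.exp (-K) * s p + Real.exp (-K) * t p) / 2)) lam :=
    hfin _ _ (Real.exp_pos _) (Real.exp_pos _)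
  have hbound : ∀ᵐ p ∂lam, ∀ x ∈ Set.Ioc (-K) K,
      |M x p| ≤ 2 * Real.exp K * Real.exp (-(Real.exp (-K) * s p + Real.exp (-K) * t p) / 2) := by
    filter_upwards [hs0, ht0] with p h1 h2 x hx
    have e1 : Real.exp x ≤ Real.exp K := Real.exp_le_exp.2 hx.2
    have e2 : Real.exp (-x) ≤ Real.exp K := Real.exp_le_exp.2 (by linarith [hx.1])
    have e3 : Real.exp (-K) ≤ Real.exp x := Real.exp_le_exp.2 hx.1.le
    have e4 : Real.exp (-K) ≤ Real.exp (-x) := Real.exp_le_exp.2 (by linarith [hx.2])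
    have p1 := Real.exp_pos x
    have p2 := Real.exp_pos (-x)
    have a1 : |(Real.exp x * s p - Real.exp (-x) * t p) / (s p + t p)| ≤ Real.exp K := by
      rw [abs_div, abs_of_pos (show 0 < s p + t p by linarith), div_le_iff₀ (by linarith), abs_le]
      constructor <;> nlinarith
    have a2 : gdE (s p) (t p) x
        ≤ Real.exp (-(Real.exp (-K) * s p + Real.exp (-K) * t p) / 2) := by
      unfold gdE
      apply Real.exp_le_exp.2
      nlinarith
    simp only [hM]
    rw [abs_mul, abs_mul, abs_mul, abs_of_pos (gdE_pos _ _ _), abs_two]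
    have := hd1 p
    calc _ ≤ 2 * 1 * Real.exp K * Real.exp (-(Real.exp (-K) * s p + Real.exp (-K) * t p) / 2) := by
          have := (gdE_pos (s p) (t p) x).le
          gcongr
      _ = _ := by ring
  have hIntg : Integrable (Function.uncurry M) ((volume.restrict (Set.Ioc (-K) K)).prod lam) := by
    have hb2 : Integrable (fun q : ℝ × Ω => (2 * Real.exp K) *
        Real.exp (-(Real.exp (-K) * s q.2 + Real.exp (-K) * t q.2) / 2))
        ((volume.restrict (Set.Ioc (-K) K)).prod lam) :=
      (integrable_const (2 * Real.exp K)).mul_prod hbase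
    refine hb2.mono' hMmeas.aestronglyMeasurable ?_
    have : ∀ᵐ q ∂((volume.restrict (Set.Ioc (-K) K)).prod lam), q.1 ∈ Set.Ioc (-K) K :=
      Measure.quasiMeasurePreserving_fst.ae (ae_restrict_mem measurableSet_Ioc)
    have h' := (Measure.quasiMeasurePreserving_snd
      (μ := volume.restrict (Set.Ioc (-K) K)) (ν := lam)).ae hbound
    filter_upwards [this, h'] with q h1 h2
    exact h2 q.1 h1
  have hNint : ∀ x, Integrable (fun p => (d p)^2 *
      ((Real.exp (-x) + Real.exp x) * gdE (s p) (t p) x)) lam := by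
    intro x
    have h := (hfin _ _ (Real.exp_pos x) (Real.exp_pos (-x))).const_mul (Real.exp (-x) + Real.exp x)
    refine h.bdd_mul (c := 1) (by fun_prop) (Filter.Eventually.of_forall fun p => ?_)
    rw [Real.norm_eq_abs, abs_pow]
    exact pow_le_one₀ (abs_nonneg _) (hd1 p)
  have hG : ∀ x, ∫⁻ p, ENNReal.ofReal ((d p)^2 *
        ((Real.exp (-x) + Real.exp x) * gdE (s p) (t p) x)) ∂lam ≤ ENNReal.ofReal (∫ p, M x p ∂lam) := by
    intro x
    rw [← ofReal_integral_eq_lintegral_ofReal (hNint x)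
      (Filter.Eventually.of_forall fun p => by
        have := gdE_pos (s p) (t p) x
        simp only [Pi.zero_apply]
        positivity)]
    exact ENNReal.ofReal_le_ofReal (hdom x)
  have hpsi0 : ∀ x, 0 ≤ ∫ p, M x p ∂lam := fun x =>
    le_trans (integral_nonneg fun p => by
      have := gdE_pos (s p) (t p) x
      simp only [Pi.zero_apply]
      positivity) (hdom x)
  have hpsi : Integrable (fun x => ∫ p, M x p ∂lam) (volume.restrict (Set.Ioc (-K) K)) :=
    hIntg.integral_prod_left
  calc _ ≤ ∫⁻ x in Set.Ioc (-K) K, ENNReal.ofReal (∫ p, M x p ∂lam) := lintegral_mono hG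
    _ = ENNReal.ofReal (∫ x in Set.Ioc (-K) K, ∫ p, M x p ∂lam) :=
        (ofReal_integral_eq_lintegral_ofReal hpsi (Filter.Eventually.of_forall hpsi0)).symm
    _ = ENNReal.ofReal (∫ p, (∫ x in Set.Ioc (-K) K, M x p) ∂lam) := by
        rw [integral_integral_swap hIntg]
    _ ≤ ‖∫ p, (∫ x in Set.Ioc (-K) K, M x p) ∂lam‖ₑ := by
        rw [← ofReal_norm]
        exact ENNReal.ofReal_le_ofReal (le_abs_self _)
    _ ≤ ∫⁻ p, ‖∫ x in Set.Ioc (-K) K, M x p‖ₑ ∂lam := enorm_integral_le_lintegral_enorm _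
    _ ≤ _ := by
        apply lintegral_mono_ae
        filter_upwards [hs0, ht0] with p h1 h2
        rw [← ofReal_norm]
        apply ENNReal.ofReal_le_ofReal
        have hst : 0 < s p + t p := by linarith
        have hftc : ∫ x in (-K)..K, M x p =
            (-4 * d p / (s p + t p)) * gdE (s p) (t p) K
              - (-4 * d p / (s p + t p)) * gdE (s p) (t p) (-K) := by
          apply intervalIntegral.integral_eq_sub_of_hasDerivAt
            (f := fun x => (-4 * d p / (s p + t p)) * gdE (s p) (t p) x)
          · intro x _
            have := (gdE_hasDerivAt (s p) (t p) x).const_mul (-4 * d p / (s p + t p))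
            refine this.congr_deriv ?_
            simp only [hM]
            field_simp
            ring
          · apply Continuous.intervalIntegrable
            simp only [hM]
            unfold gdE
            fun_prop
        rw [← intervalIntegral.integral_of_le (by linarith), hftc, ← mul_sub, Real.norm_eq_abs,
          abs_mul, abs_div, abs_mul, abs_of_pos hst]
        apply le_of_eq
        rw [abs_neg, abs_of_pos (show (0:ℝ) < 4 by norm_num)]
        ring

lemma gd_main {Ω : Type*} [MeasurableSpace Ω] (lam : Measure Ω) [SFinite lam] (s t d : Ω → ℝ)
    (hs : Measurable s) (ht : Measurable t) (hd : Measurable d)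
    (hsn : ∀ p, 0 ≤ s p) (htn : ∀ p, 0 ≤ t p)
    (hs0 : ∀ᵐ p ∂lam, 0 < s p) (ht0 : ∀ᵐ p ∂lam, 0 < t p) (hd1 : ∀ p, |d p| ≤ 1)
    (B : ℝ) (hB0 : 0 ≤ B)
    (hB : ∀ c₁ c₂ : ℝ, 0 < c₁ → 0 < c₂ → 1 ≤ c₁ * c₂ →
      ∫⁻ p, ENNReal.ofReal (Real.exp (-(c₁ * s p + c₂ * t p) / 2)) ∂lam
        ≤ ENNReal.ofReal (B / Real.sqrt (c₁ * c₂)))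
    (hfin : ∀ c₁ c₂ : ℝ, 0 < c₁ → 0 < c₂ →
      Integrable (fun p => Real.exp (-(c₁ * s p + c₂ * t p) / 2)) lam)
    (hdom : ∀ x : ℝ, ∫ p, (d p)^2 * ((Real.exp (-x) + Real.exp x) * gdE (s p) (t p) x) ∂lam
      ≤ ∫ p, 2 * d p * ((Real.exp x * s p - Real.exp (-x) * t p) / (s p + t p))
        * gdE (s p) (t p) x ∂lam) :
    ∀ᵐ p ∂lam, d p = 0 := by
  have hmeas : Measurable (fun q : ℝ × Ω => ENNReal.ofReal ((d q.2)^2 *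
        ((Real.exp (-q.1) + Real.exp q.1) * gdE (s q.2) (t q.2) q.1))) := by
    unfold gdE; fun_prop
  set G : ℝ → ENNReal := fun x => ∫⁻ p, ENNReal.ofReal ((d p)^2 *
        ((Real.exp (-x) + Real.exp x) * gdE (s p) (t p) x)) ∂lam with hG
  have hGm : Measurable G := hmeas.lintegral_prod_right'
  have ha := gd_aprime lam s t hs ht hsn htn B hB0 hB
  have hb := gd_b lam s t d hs ht hd hs0 ht0
  have hc := gd_c lam s t d hs ht hd hs0 ht0 hd1 hfin hdom
  set C : ENNReal := ENNReal.ofReal B * ENNReal.ofReal Real.pi with hC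
  have hzero : (volume.withDensity G) Set.univ = 0 := by
    apply gd_limit (volume.withDensity G) C (by simp [hC, ENNReal.mul_ne_top])
    · intro k
      have hk : (0:ℝ) ≤ k := by positivity
      rw [withDensity_apply _ measurableSet_Ioc]
      refine (hc k hk).trans ?_
      refine le_trans ?_ (mul_le_mul_right (ha k hk) 4)
      rw [← lintegral_const_mul _ (by unfold gdE; fun_prop)]
      apply lintegral_mono
      intro p
      dsimp only
      rw [show (4:ENNReal) = ENNReal.ofReal 4 by simp, ← ENNReal.ofReal_mul (by norm_num)]
      apply ENNReal.ofReal_le_ofReal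
      rw [mul_div_assoc]
      have h1 : 0 ≤ |gdE (s p) (t p) k - gdE (s p) (t p) (-k)| / (s p + t p) :=
        div_nonneg (abs_nonneg _) (add_nonneg (hsn p) (htn p))
      have := hd1 p
      nlinarith
    · intro k ε hε
      have hk : (0:ℝ) ≤ k := by positivity
      rw [withDensity_apply _ measurableSet_Ioc, withDensity_apply _ measurableSet_Ioc.compl]
      refine (hc k hk).trans ?_
      refine le_trans ?_ (add_le_add (mul_le_mul_right (hb k hk) _) (mul_le_mul_right (ha k hk) _))
      rw [← lintegral_const_mul _ (by unfold gdE; fun_prop),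
        ← lintegral_const_mul _ (by unfold gdE; fun_prop),
        ← lintegral_add_left (by unfold gdE; fun_prop)]
      apply lintegral_mono_ae
      filter_upwards [hs0, ht0] with p h1 h2
      have hab := abs_nonneg (gdE (s p) (t p) k - gdE (s p) (t p) (-k))
      rw [← ENNReal.ofReal_mul (by positivity), ← ENNReal.ofReal_mul (by positivity),
        ← ENNReal.ofReal_add (by positivity) (by positivity)]
      exact ENNReal.ofReal_le_ofReal (gd_amgm _ _ _ _ ε h1 h2 hε)
  rw [withDensity_apply _ MeasurableSet.univ, Measure.restrict_univ, lintegral_eq_zero_iff hGm] at hzero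
  obtain ⟨x, hx⟩ := hzero.exists
  have hx' : ∫⁻ p, ENNReal.ofReal ((d p)^2 *
        ((Real.exp (-x) + Real.exp x) * gdE (s p) (t p) x)) ∂lam = 0 := hx
  rw [lintegral_eq_zero_iff (by unfold gdE; fun_prop)] at hx'
  filter_upwards [hx'] with p hp
  have h1 : (d p)^2 * ((Real.exp (-x) + Real.exp x) * gdE (s p) (t p) x) ≤ 0 :=
    ENNReal.ofReal_eq_zero.1 hp
  have h2 : 0 < (Real.exp (-x) + Real.exp x) * gdE (s p) (t p) x :=
    mul_pos (by positivity) (gdE_pos _ _ _)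
  have h3 : (d p)^2 ≤ 0 := by
    by_contra h
    push Not at h
    exact absurd h1 (not_le.2 (mul_pos h h2))
  exact pow_eq_zero_iff (two_ne_zero) |>.1 (le_antisymm h3 (sq_nonneg _))

lemma gd_gauss_int (m : ℕ) (c : ℝ) (hc : 0 < c) :
    Integrable (fun u : Fin m → ℝ => Real.exp (-(c * ∑ i, (u i)^2) / 2)) ∧
    ∫ u : Fin m → ℝ, Real.exp (-(c * ∑ i, (u i)^2) / 2) = Real.sqrt (2 * Real.pi / c) ^ m := by
  have h1 : (fun u : Fin m → ℝ => Real.exp (-(c * ∑ i, (u i)^2) / 2))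
      = fun u => ∏ i, Real.exp (-(c/2) * (u i)^2) := by
    funext u
    rw [← Real.exp_sum, ← Finset.mul_sum]
    congr 1; ring
  rw [h1]
  refine ⟨Integrable.fintype_prod (fun i => integrable_exp_neg_mul_sq (by positivity)), ?_⟩
  rw [integral_fintype_prod_volume_eq_pow (fun x : ℝ => Real.exp (-(c/2) * x^2)), integral_gaussian,
    Fintype.card_fin]
  congr 2
  field_simp

lemma gd_gauss_prod (m : ℕ) (c₁ c₂ : ℝ) (h₁ : 0 < c₁) (h₂ : 0 < c₂) :
    Integrable (fun p : (Fin m → ℝ) × (Fin m → ℝ) =>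
      Real.exp (-(c₁ * (∑ i, (p.1 i)^2) + c₂ * (∑ i, (p.2 i)^2)) / 2)) ∧
    ∫ p : (Fin m → ℝ) × (Fin m → ℝ),
      Real.exp (-(c₁ * (∑ i, (p.1 i)^2) + c₂ * (∑ i, (p.2 i)^2)) / 2)
      = (2 * Real.pi / Real.sqrt (c₁ * c₂)) ^ m := by
  have e : (fun p : (Fin m → ℝ) × (Fin m → ℝ) =>
      Real.exp (-(c₁ * (∑ i, (p.1 i)^2) + c₂ * (∑ i, (p.2 i)^2)) / 2))
      = fun p => Real.exp (-(c₁ * ∑ i, (p.1 i)^2) / 2) * Real.exp (-(c₂ * ∑ i, (p.2 i)^2) / 2) := by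
    funext p
    rw [← Real.exp_add]; congr 1; ring
  rw [e]
  obtain ⟨i1, e1⟩ := gd_gauss_int m c₁ h₁
  obtain ⟨i2, e2⟩ := gd_gauss_int m c₂ h₂
  refine ⟨i1.mul_prod i2, ?_⟩
  rw [Measure.volume_eq_prod, integral_prod_mul (fun u : Fin m → ℝ => Real.exp (-(c₁ * ∑ i, (u i)^2) / 2))
    (fun u : Fin m → ℝ => Real.exp (-(c₂ * ∑ i, (u i)^2) / 2)), e1, e2, ← mul_pow,
    ← Real.sqrt_mul (by positivity)]
  congr 1
  rw [show 2 * Real.pi / c₁ * (2 * Real.pi / c₂) = (2 * Real.pi)^2 / (c₁ * c₂) by field_simp,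
    Real.sqrt_div (by positivity), Real.sqrt_sq (by positivity)]

lemma gd_sumsq_pos (m : ℕ) (hm : 1 ≤ m) :
    ∀ᵐ u : Fin m → ℝ, 0 < ∑ i, (u i)^2 := by
  have : Nonempty (Fin m) := ⟨⟨0, hm⟩⟩
  have h0 : ∀ᵐ u : Fin m → ℝ, u ≠ 0 := by
    exact Measure.ae_ne volume 0
  filter_upwards [h0] with u hu
  obtain ⟨i, hi⟩ := Function.ne_iff.1 hu
  have hi' : u i ≠ 0 := hi
  exact Finset.sum_pos' (fun j _ => sq_nonneg _) ⟨i, Finset.mem_univ _, by positivity⟩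

lemma gd_weight_S (m : ℕ) (hm : 1 ≤ m) (p : (Fin m → ℝ) × (Fin m → ℝ)) :
    gdWeight (gdS m p) = (∑ i, (p.1 i)^2) / ((∑ i, (p.1 i)^2) + (∑ i, (p.2 i)^2)) := by
  have : (m:ℝ) ≠ 0 := by positivity
  unfold gdWeight gdS
  dsimp only
  rw [← add_div, div_div_div_cancel_right₀ this]

lemma gd_weight_mem (m : ℕ) (hm : 1 ≤ m) (p : (Fin m → ℝ) × (Fin m → ℝ)) :
    gdWeight (gdS m p) ∈ Set.Icc (0:ℝ) 1 := by
  rw [gd_weight_S m hm]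
  have h1 : 0 ≤ ∑ i, (p.1 i)^2 := Finset.sum_nonneg fun _ _ => sq_nonneg _
  have h2 : 0 ≤ ∑ i, (p.2 i)^2 := Finset.sum_nonneg fun _ _ => sq_nonneg _
  exact ⟨by positivity, div_le_one_of_le₀ (by linarith) (by positivity)⟩

lemma gd_weight_measurable : Measurable gdWeight := by
  unfold gdWeight; fun_prop

lemma gd_quad_integrable (m : ℕ) (x : ℝ) (f : (Fin m → ℝ) × (Fin m → ℝ) → ℝ) (hf : Measurable f)
    (hb : ∀ p, f p ∈ Set.Icc (0:ℝ) 1) :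
    Integrable (fun p : (Fin m → ℝ) × (Fin m → ℝ) =>
      ((1 - f p)^2 * Real.exp (-x) + (f p)^2 * Real.exp x) *
        gdE (∑ i, (p.1 i)^2) (∑ i, (p.2 i)^2) x) := by
  refine (gd_gauss_prod m _ _ (Real.exp_pos x) (Real.exp_pos (-x))).1.bdd_mul
    (c := Real.exp (-x) + Real.exp x) (by fun_prop) (Filter.Eventually.of_forall fun p => ?_)
  obtain ⟨h0, h1⟩ := hb p
  have e1 := Real.exp_pos x
  have e2 := Real.exp_pos (-x)
  rw [Real.norm_eq_abs, abs_of_nonneg (by positivity)]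
  have a1 : (1 - f p)^2 ≤ 1 := by nlinarith
  have a2 : (f p)^2 ≤ 1 := by nlinarith
  nlinarith

lemma gd_diff_ae_zero (m : ℕ) (hm : 1 ≤ m) (φ : ℝ × ℝ → ℝ) (hφ : Measurable φ)
    (hφ1 : ∀ s, φ s ∈ Set.Icc (0:ℝ) 1)
    (hdom : ∀ μ v₁ v₂ : ℝ, 0 < v₁ → 0 < v₂ →
        risk (m+1) μ v₁ v₂ φ ≤ risk (m+1) μ v₁ v₂ gdWeight) :
    ∀ᵐ p : (Fin m → ℝ) × (Fin m → ℝ), gdWeight (gdS m p) - φ (gdS m p) = 0 := by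
  have hSm := gd_measurable_S m
  have hgm := gd_weight_measurable
  have hs0 : ∀ᵐ p : (Fin m → ℝ) × (Fin m → ℝ), 0 < ∑ i, (p.1 i)^2 :=
    Measure.quasiMeasurePreserving_fst.ae (gd_sumsq_pos m hm)
  have ht0 : ∀ᵐ p : (Fin m → ℝ) × (Fin m → ℝ), 0 < ∑ i, (p.2 i)^2 :=
    Measure.quasiMeasurePreserving_snd.ae (gd_sumsq_pos m hm)
  have hd1 : ∀ p : (Fin m → ℝ) × (Fin m → ℝ), |gdWeight (gdS m p) - φ (gdS m p)| ≤ 1 := by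
    intro p
    obtain ⟨a, b⟩ := gd_weight_mem m hm p
    obtain ⟨c, d⟩ := hφ1 (gdS m p)
    rw [abs_le]; constructor <;> linarith
  refine gd_main (volume : Measure ((Fin m → ℝ) × (Fin m → ℝ)))
    (fun p => ∑ i, (p.1 i)^2) (fun p => ∑ i, (p.2 i)^2)
    (fun p => gdWeight (gdS m p) - φ (gdS m p)) (by fun_prop) (by fun_prop) (by fun_prop)
    (fun p => Finset.sum_nonneg fun _ _ => sq_nonneg _)
    (fun p => Finset.sum_nonneg fun _ _ => sq_nonneg _) hs0 ht0 hd1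
    ((2 * Real.pi)^m) (by positivity) ?_ (fun c₁ c₂ h₁ h₂ => (gd_gauss_prod m c₁ c₂ h₁ h₂).1) ?_
  · intro c₁ c₂ h₁ h₂ h12
    obtain ⟨hi, he⟩ := gd_gauss_prod m c₁ c₂ h₁ h₂
    rw [← ofReal_integral_eq_lintegral_ofReal hi
      (Filter.Eventually.of_forall fun p => (Real.exp_pos _).le), he]
    apply ENNReal.ofReal_le_ofReal
    have hsq : 1 ≤ Real.sqrt (c₁ * c₂) := Real.one_le_sqrt.2 h12
    rw [div_pow]
    gcongr
    exact le_self_pow₀ hsq (by omega)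
  · intro x
    obtain ⟨C, hC, hform⟩ := gd_risk_formula m 0 (Real.exp (-x)) (Real.exp x)
      (Real.exp_pos _) (Real.exp_pos _)
    have h := hdom 0 (Real.exp (-x)) (Real.exp x) (Real.exp_pos _) (Real.exp_pos _)
    rw [hform φ hφ, hform gdWeight hgm] at h
    have h' := le_of_mul_le_mul_left h hC
    have hE : ∀ p : (Fin m → ℝ) × (Fin m → ℝ),
        Real.exp (-((∑ i, (p.1 i)^2) / Real.exp (-x) + (∑ i, (p.2 i)^2) / Real.exp x) / 2)
          = gdE (∑ i, (p.1 i)^2) (∑ i, (p.2 i)^2) x := by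
      intro p
      unfold gdE
      congr 3
      rw [Real.exp_neg]
      field_simp
    simp_rw [hE] at h'
    have i1 := gd_quad_integrable m x (fun p => φ (gdS m p)) (by fun_prop) (fun p => hφ1 _)
    have i2 := gd_quad_integrable m x (fun p => gdWeight (gdS m p)) (by fun_prop)
      (fun p => gd_weight_mem m hm p)
    have i3 : Integrable (fun p : (Fin m → ℝ) × (Fin m → ℝ) =>
        (gdWeight (gdS m p) - φ (gdS m p))^2 * ((Real.exp (-x) + Real.exp x) *
          gdE (∑ i, (p.1 i)^2) (∑ i, (p.2 i)^2) x)) := by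
      refine ((gd_gauss_prod m _ _ (Real.exp_pos x) (Real.exp_pos (-x))).1.const_mul
        (Real.exp (-x) + Real.exp x)).bdd_mul
        (c := 1) (by fun_prop) (Filter.Eventually.of_forall fun p => ?_)
      rw [Real.norm_eq_abs, abs_pow]
      exact pow_le_one₀ (abs_nonneg _) (hd1 p)
    have hid : ∫ p : (Fin m → ℝ) × (Fin m → ℝ),
        2 * (gdWeight (gdS m p) - φ (gdS m p)) *
          ((Real.exp x * (∑ i, (p.1 i)^2) - Real.exp (-x) * (∑ i, (p.2 i)^2))
            / ((∑ i, (p.1 i)^2) + (∑ i, (p.2 i)^2)))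
          * gdE (∑ i, (p.1 i)^2) (∑ i, (p.2 i)^2) x
        = ∫ p : (Fin m → ℝ) × (Fin m → ℝ),
          ((((1 - gdWeight (gdS m p))^2 * Real.exp (-x) + (gdWeight (gdS m p))^2 * Real.exp x) *
            gdE (∑ i, (p.1 i)^2) (∑ i, (p.2 i)^2) x
          - ((1 - φ (gdS m p))^2 * Real.exp (-x) + (φ (gdS m p))^2 * Real.exp x) *
            gdE (∑ i, (p.1 i)^2) (∑ i, (p.2 i)^2) x)
          + (gdWeight (gdS m p) - φ (gdS m p))^2 * ((Real.exp (-x) + Real.exp x) *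
          gdE (∑ i, (p.1 i)^2) (∑ i, (p.2 i)^2) x)) := by
      apply integral_congr_ae
      filter_upwards [hs0, ht0] with p h1 h2
      have hst : (∑ i, (p.1 i)^2) + (∑ i, (p.2 i)^2) ≠ 0 := by positivity
      have hk : (Real.exp x * (∑ i, (p.1 i)^2) - Real.exp (-x) * (∑ i, (p.2 i)^2))
            / ((∑ i, (p.1 i)^2) + (∑ i, (p.2 i)^2))
          = (Real.exp (-x) + Real.exp x) * gdWeight (gdS m p) - Real.exp (-x) := by
        rw [gd_weight_S m hm]
        field_simp
        ring
      rw [hk]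
      ring
    have e1 := integral_add (i2.sub i1) i3
    have e2 := integral_sub i2 i1
    simp only [Pi.sub_apply] at e1
    rw [hid, e1, e2]
    linarith

/-- The Graybill–Deal estimator is admissible among the class
`𝓒₁ = {X̄₁ + (X̄₂ - X̄₁)·φ(S₁², S₂²) : φ measurable into [0,1]}`. -/
theorem graybillDeal_admissible (n : ℕ) (hn : 2 ≤ n) :
    ¬ ∃ φ : ℝ × ℝ → ℝ, Measurable φ ∧ (∀ s, φ s ∈ Set.Icc (0 : ℝ) 1) ∧
      (∀ μ v₁ v₂ : ℝ, 0 < v₁ → 0 < v₂ →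
        risk n μ v₁ v₂ φ ≤ risk n μ v₁ v₂ gdWeight) ∧
      (∃ μ v₁ v₂ : ℝ, 0 < v₁ ∧ 0 < v₂ ∧
        risk n μ v₁ v₂ φ < risk n μ v₁ v₂ gdWeight) := by

  rintro ⟨φ, hφ, hφ1, hdom, μ, v₁, v₂, h₁, h₂, hlt⟩
  obtain ⟨m, rfl⟩ : ∃ m, n = m + 1 := ⟨n - 1, by omega⟩
  have hm : 1 ≤ m := by omega
  have hae := gd_diff_ae_zero m hm φ hφ hφ1 hdom
  obtain ⟨C, _, hform⟩ := gd_risk_formula m μ v₁ v₂ h₁ h₂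
  rw [hform φ hφ, hform gdWeight gd_weight_measurable] at hlt
  refine absurd hlt (not_lt.2 (le_of_eq ?_))
  congr 1
  apply integral_congr_ae
  filter_upwards [hae] with p hp
  rw [sub_eq_zero.1 hp]
end

section
/- Fix a natural number n ≥ 2. For θ = (μ, v₁, v₂) ∈ ℝ × (0,∞) × (0,∞), let P_θ be the product probability measure on (Fin n → ℝ) × (Fin n → ℝ) given by P_θ = (gaussianReal μ v₁)^{⊗n} ⊗ (gaussianReal μ v₂)^{⊗n}. For a sample x = (x₁, x₂) let X̄ᵢ(x) = (1/n) ∑ⱼ xᵢ(j) and Sᵢ²(x) = (1/(n−1)) ∑ⱼ (xᵢ(j) − X̄ᵢ(x))². For a measurable function φ : ℝ × ℝ → [0,1] define the estimator δ_φ(x) = X̄₁(x) + (X̄₂(x) − X̄₁(x)) · φ(S₁²(x), S₂²(x)) and its risk R(θ, φ) = ∫ (δ_φ(x) − μ)² dP_θ(x). Then for every measurable φ : ℝ × ℝ → [0,1] and every θ = (μ, v₁, v₂), R(θ, φ) = v₁ v₂ / (n (v₁ + v₂)) + ((v₁ + v₂)/n) · ∫ (φ(S₁²(x), S₂²(x))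 − v₁/(v₁ + v₂))² dP_θ(x). -/
open MeasureTheory ProbabilityTheory

section helpers

lemma measurable_sampleMean' (n : ℕ) : Measurable (sampleMean n) := by
  unfold sampleMean; fun_prop

lemma measurable_sampleVar' (n : ℕ) : Measurable (sampleVar n) := by
  have := measurable_sampleMean' n
  unfold sampleVar; fun_prop

lemma hasGaussianLaw_pi_id (n : ℕ) (μ : ℝ) (v : NNReal) :
    HasGaussianLaw (fun x : Fin n → ℝ => fun i => x i)
      (Measure.pi fun _ : Fin n => gaussianReal μ v) := by
  refine iIndepFun.hasGaussianLaw (X := fun i (x : Fin n → ℝ) => x i) (fun i => ?_) ?_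
  · refine HasLaw.hasGaussianLaw (μ := gaussianReal μ v) ⟨(measurable_pi_apply i).aemeasurable, ?_⟩
    exact (measurePreserving_eval (fun _ : Fin n => gaussianReal μ v) i).map_eq
  · exact iIndepFun_pi (X := fun _ => id) (fun _ => aemeasurable_id)

lemma memLp_eval_pi (n : ℕ) (μ : ℝ) (v : NNReal) (i : Fin n) :
    MemLp (fun x : Fin n → ℝ => x i) 2 (Measure.pi fun _ : Fin n => gaussianReal μ v) :=
  ((hasGaussianLaw_pi_id n μ v).eval i).memLp_two

lemma cov_eval_pi (n : ℕ) (μ : ℝ) (v : NNReal) (i j : Fin n) :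
    cov[fun x : Fin n → ℝ => x i, fun x => x j; Measure.pi fun _ : Fin n => gaussianReal μ v]
      = if i = j then (v : ℝ) else 0 := by
  split_ifs with h
  · subst h
    rw [covariance_self (measurable_pi_apply i).aemeasurable]
    have := (measurePreserving_eval (fun _ : Fin n => gaussianReal μ v) i)
    have h2 := this.variance_fun_comp (f := fun x => x) (by fun_prop)
    simpa using h2
  · exact ((iIndepFun_pi (μ := fun _ : Fin n => gaussianReal μ v) (X := fun _ => id)
      (fun _ => aemeasurable_id)).indepFun h).covariance_eq_zero
      (memLp_eval_pi n μ v i) (memLp_eval_pi n μ v j)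

lemma memLp_sampleMean (n : ℕ) (μ : ℝ) (v : NNReal) :
    MemLp (sampleMean n) 2 (Measure.pi fun _ : Fin n => gaussianReal μ v) := by
  unfold sampleMean
  simp_rw [div_eq_mul_inv]
  exact (memLp_finsetSum _ fun i _ => memLp_eval_pi n μ v i).mul_const _

lemma cov_sampleMean_eval (n : ℕ) (μ : ℝ) (v : NNReal) (j : Fin n) :
    cov[sampleMean n, fun x => x j; Measure.pi fun _ : Fin n => gaussianReal μ v] = v / n := by
  unfold sampleMean
  rw [covariance_fun_div_left, covariance_fun_sum_left (fun i => memLp_eval_pi n μ v i)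
    (memLp_eval_pi n μ v j)]
  simp [cov_eval_pi]

lemma variance_sampleMean (n : ℕ) (hn : n ≠ 0) (μ : ℝ) (v : NNReal) :
    cov[sampleMean n, sampleMean n; Measure.pi fun _ : Fin n => gaussianReal μ v] = v / n := by
  have h : cov[sampleMean n, fun x => (∑ j, x j) / n;
      Measure.pi fun _ : Fin n => gaussianReal μ v] = v / n := by
    rw [covariance_fun_div_right, covariance_fun_sum_right (fun i => memLp_eval_pi n μ v i)
      (memLp_sampleMean n μ v)]
    simp [cov_sampleMean_eval]
    field_simp
  exact h

lemma integral_sampleMean (n : ℕ) (hn : n ≠ 0) (μ : ℝ) (v : NNReal) :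
    ∫ x, sampleMean n x ∂(Measure.pi fun _ : Fin n => gaussianReal μ v) = μ := by
  unfold sampleMean
  rw [integral_div, integral_finsetSum _
    (fun i _ => (memLp_eval_pi n μ v i).integrable (by norm_num))]
  have : ∀ i : Fin n, ∫ x, x i ∂(Measure.pi fun _ : Fin n => gaussianReal μ v) = μ := by
    intro i
    have := integral_comp_eval (μ := fun _ : Fin n => gaussianReal μ v) (i := i)
      (f := fun x : ℝ => x) (by fun_prop)
    simpa using this
  simp [this]
  field_simp

lemma integral_sampleMean_sub (n : ℕ) (hn : n ≠ 0) (μ : ℝ) (v : NNReal) :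
    ∫ x, (sampleMean n x - μ) ∂(Measure.pi fun _ : Fin n => gaussianReal μ v) = 0 := by
  rw [integral_sub ((memLp_sampleMean n μ v).integrable (by norm_num)) (integrable_const _),
    integral_sampleMean n hn]
  simp

lemma integral_sampleMean_sq (n : ℕ) (hn : n ≠ 0) (μ : ℝ) (v : NNReal) :
    ∫ x, (sampleMean n x - μ) ^ 2 ∂(Measure.pi fun _ : Fin n => gaussianReal μ v) = v / n := by
  rw [← variance_sampleMean n hn μ v, covariance, integral_sampleMean n hn]
  simp_rw [pow_two]

lemma indepFun_mean_var (n : ℕ) (hn : n ≠ 0) (μ : ℝ) (v : NNReal) :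
    IndepFun (sampleMean n) (sampleVar n) (Measure.pi fun _ : Fin n => gaussianReal μ v) := by
  have key : IndepFun (fun x (_ : Fin 1) => sampleMean n x)
      (fun x (j : Fin n) => x j - sampleMean n x)
      (Measure.pi fun _ : Fin n => gaussianReal μ v) := by
    refine HasGaussianLaw.indepFun_of_covariance_eval
      (X := fun (_ : Fin 1) => sampleMean n) (Y := fun (j : Fin n) x => x j - sampleMean n x)
      ?_ ?_
    · let m : (Fin n → ℝ) →L[ℝ] ℝ :=
        (n : ℝ)⁻¹ • ∑ j, ContinuousLinearMap.proj (R := ℝ) (φ := fun _ : Fin n => ℝ) j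
      let L : (Fin n → ℝ) →L[ℝ] ((Fin 1 → ℝ) × (Fin n → ℝ)) :=
        (ContinuousLinearMap.pi fun _ => m).prod
          (ContinuousLinearMap.pi fun j => ContinuousLinearMap.proj j - m)
      convert! (hasGaussianLaw_pi_id n μ v).map_fun L using 2
      rename_i x
      have hm : m x = sampleMean n x := by
        simp [m, sampleMean, div_eq_inv_mul]
      change _ = L x
      ext j <;> simp [L, hm]
    · intro i j
      rw [covariance_fun_sub_right (memLp_sampleMean n μ v) (memLp_eval_pi n μ v j)
        (memLp_sampleMean n μ v), cov_sampleMean_eval, variance_sampleMean n hn, sub_self]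
  exact key.comp (φ := fun y : Fin 1 → ℝ => y 0)
    (ψ := fun y : Fin n → ℝ => (∑ j, (y j) ^ 2) / ((n : ℝ) - 1)) (by fun_prop) (by fun_prop)

variable {α β : Type*} [MeasurableSpace α] [MeasurableSpace β]

lemma factor_left (P : Measure α) (Q : Measure β) [IsProbabilityMeasure P] [IsProbabilityMeasure Q]
    (m s : α → ℝ) (hm : Measurable m) (hs : Measurable s) (h : IndepFun m s P)
    (f : ℝ → ℝ) (hf : Measurable f) (g : ℝ × β → ℝ) (hg : Measurable g)
    (hi : Integrable (fun x : α × β => f (m x.1) * g (s x.1, x.2)) (P.prod Q))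
    (hgi : Integrable (fun x : α × β => g (s x.1, x.2)) (P.prod Q)) :
    ∫ x, f (m x.1) * g (s x.1, x.2) ∂(P.prod Q)
      = (∫ x, f (m x) ∂P) * ∫ x, g (s x.1, x.2) ∂(P.prod Q) := by
  rw [integral_prod_symm _ hi, integral_prod_symm _ hgi, ← integral_const_mul]
  congr 1
  ext y
  exact h.integral_fun_comp_mul_comp (g := fun z => g (z, y)) hm.aemeasurable hs.aemeasurable
    hf.aestronglyMeasurable (hg.comp measurable_prodMk_right).aestronglyMeasurable

lemma factor_right (P : Measure α) (Q : Measure β) [IsProbabilityMeasure P]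
    [IsProbabilityMeasure Q]
    (m s : β → ℝ) (hm : Measurable m) (hs : Measurable s) (h : IndepFun m s Q)
    (f : ℝ → ℝ) (hf : Measurable f) (g : α × ℝ → ℝ) (hg : Measurable g)
    (hi : Integrable (fun x : α × β => f (m x.2) * g (x.1, s x.2)) (P.prod Q))
    (hgi : Integrable (fun x : α × β => g (x.1, s x.2)) (P.prod Q)) :
    ∫ x, f (m x.2) * g (x.1, s x.2) ∂(P.prod Q)
      = (∫ x, f (m x) ∂Q) * ∫ x, g (x.1, s x.2) ∂(P.prod Q) := by
  rw [integral_prod _ hi, integral_prod _ hgi, ← integral_const_mul]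
  congr 1
  ext y
  exact h.integral_fun_comp_mul_comp (g := fun z => g (y, z)) hm.aemeasurable hs.aemeasurable
    hf.aestronglyMeasurable (hg.comp measurable_prodMk_left).aestronglyMeasurable

end helpers

/-- Risk decomposition for the class `𝓒₁`:
`R(θ, φ) = v₁v₂/(n(v₁+v₂)) + ((v₁+v₂)/n)·E[(φ(S₁², S₂²) - v₁/(v₁+v₂))²]`. -/
theorem risk_decomposition (n : ℕ) (hn : 2 ≤ n)
    (φ : ℝ × ℝ → ℝ) (hφmeas : Measurable φ) (hφ : ∀ s, φ s ∈ Set.Icc (0 : ℝ) 1)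
    (μ v₁ v₂ : ℝ) (hv₁ : 0 < v₁) (hv₂ : 0 < v₂) :
    risk n μ v₁ v₂ φ =
      v₁ * v₂ / (n * (v₁ + v₂)) +
      (v₁ + v₂) / n *
        ∫ x, (φ (sampleVar n x.1, sampleVar n x.2) - v₁ / (v₁ + v₂)) ^ 2
          ∂(sampleLaw n μ v₁ v₂) := by
  have hn0 : n ≠ 0 := by omega
  have hnR : (n : ℝ) ≠ 0 := by exact_mod_cast hn0
  have hM := measurable_sampleMean' n
  have hS := measurable_sampleVar' n
  unfold risk sampleLaw estimatorOf
  set P := Measure.pi fun _ : Fin n => gaussianReal μ v₁.toNNReal with hP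
  set Q := Measure.pi fun _ : Fin n => gaussianReal μ v₂.toNNReal with hQ
  set w : (Fin n → ℝ) × (Fin n → ℝ) → ℝ := fun x => φ (sampleVar n x.1, sampleVar n x.2) with hw
  have hwm : Measurable w := by fun_prop
  have hw01 : ∀ x, 0 ≤ w x ∧ w x ≤ 1 := fun x => hφ _
  -- bounded polynomial weights are integrable against anything integrable
  have hbd : ∀ (F G : (Fin n → ℝ) × (Fin n → ℝ) → ℝ), Integrable F (P.prod Q) → Measurable G →
      (∀ x, |G x| ≤ 1) → Integrable (fun x => F x * G x) (P.prod Q) := by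
    intro F G hF hG hb
    exact hF.mul_bdd (c := 1) hG.aestronglyMeasurable (Filter.Eventually.of_forall hb)
  have hbd1 : ∀ (G : (Fin n → ℝ) × (Fin n → ℝ) → ℝ), Measurable G →
      (∀ x, |G x| ≤ 1) → Integrable G (P.prod Q) := by
    intro G hG hb
    simpa using hbd (fun _ => 1) G (integrable_const _) hG hb
  have b1 : ∀ x, |(1 - w x) ^ 2| ≤ 1 := fun x => by
    rw [abs_le]; constructor <;> nlinarith [hw01 x]
  have b2 : ∀ x, |w x ^ 2| ≤ 1 := fun x => by
    rw [abs_le]; constructor <;> nlinarith [hw01 x]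
  have b3 : ∀ x, |w x * (1 - w x)| ≤ 1 := fun x => by
    rw [abs_le]; constructor <;> nlinarith [hw01 x]
  have b4 : ∀ x, |w x| ≤ 1 := fun x => by
    rw [abs_le]; constructor <;> nlinarith [hw01 x]
  have ma : MemLp (fun x => sampleMean n x - μ) 2 P := (memLp_sampleMean n μ _).sub (memLp_const μ)
  have mb : MemLp (fun x => sampleMean n x - μ) 2 Q := (memLp_sampleMean n μ _).sub (memLp_const μ)
  have ia2 : Integrable (fun x : (Fin n → ℝ) × (Fin n → ℝ) => (sampleMean n x.1 - μ) ^ 2)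
      (P.prod Q) := ma.integrable_sq.comp_fst Q
  have ib2 : Integrable (fun x : (Fin n → ℝ) × (Fin n → ℝ) => (sampleMean n x.2 - μ) ^ 2)
      (P.prod Q) := mb.integrable_sq.comp_snd P
  have ib : Integrable (fun x : (Fin n → ℝ) × (Fin n → ℝ) => (sampleMean n x.2 - μ))
      (P.prod Q) := (mb.integrable (by norm_num)).comp_snd P
  have iab : Integrable (fun x : (Fin n → ℝ) × (Fin n → ℝ) =>
      (sampleMean n x.1 - μ) * (sampleMean n x.2 - μ)) (P.prod Q) :=
    (ma.integrable (by norm_num)).mul_prod (mb.integrable (by norm_num))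
  have i1 := hbd _ (fun x => (1 - w x) ^ 2) ia2 (by fun_prop) b1
  have i2 := hbd _ (fun x => w x ^ 2) ib2 (by fun_prop) b2
  have i3 := hbd _ (fun x => w x * (1 - w x)) iab (by fun_prop) b3
  have i3' := hbd _ (fun x => w x * (1 - w x)) ib (by fun_prop) b3
  have iw := hbd1 w hwm b4
  have iw2 := hbd1 (fun x => w x ^ 2) (by fun_prop) b2
  have e1 : ∫ x, (sampleMean n x.1 - μ) ^ 2 * (1 - w x) ^ 2 ∂(P.prod Q)
      = v₁ / n * ∫ x, (1 - w x) ^ 2 ∂(P.prod Q) := by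
    have := factor_left P Q (sampleMean n) (sampleVar n) hM hS (indepFun_mean_var n hn0 μ _)
      (fun y => (y - μ) ^ 2) (by fun_prop)
      (fun z => (1 - φ (z.1, sampleVar n z.2)) ^ 2) (by fun_prop) i1
      (hbd1 (fun x => (1 - w x) ^ 2) (by fun_prop) b1)
    rw [integral_sampleMean_sq n hn0, Real.coe_toNNReal _ hv₁.le] at this
    exact this
  have e2 : ∫ x, (sampleMean n x.2 - μ) ^ 2 * w x ^ 2 ∂(P.prod Q)
      = v₂ / n * ∫ x, w x ^ 2 ∂(P.prod Q) := by
    have := factor_right P Q (sampleMean n) (sampleVar n) hM hS (indepFun_mean_var n hn0 μ _)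
      (fun y => (y - μ) ^ 2) (by fun_prop)
      (fun z => φ (sampleVar n z.1, z.2) ^ 2) (by fun_prop) i2 iw2
    rw [integral_sampleMean_sq n hn0, Real.coe_toNNReal _ hv₂.le] at this
    exact this
  have e3 : ∫ x, (sampleMean n x.1 - μ) * (sampleMean n x.2 - μ) * (w x * (1 - w x)) ∂(P.prod Q)
      = 0 := by
    have := factor_left P Q (sampleMean n) (sampleVar n) hM hS (indepFun_mean_var n hn0 μ _)
      (fun y => y - μ) (by fun_prop)
      (fun z => (sampleMean n z.2 - μ) *
        (φ (z.1, sampleVar n z.2) * (1 - φ (z.1, sampleVar n z.2)))) (by fun_prop)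
      (by simpa only [mul_assoc] using i3) i3'
    rw [integral_sampleMean_sub n hn0, zero_mul] at this
    rw [← this]
    simp only [hw, mul_assoc]
  have f1 : ∫ x, (1 - w x) ^ 2 ∂(P.prod Q)
      = 1 - 2 * ∫ x, w x ∂(P.prod Q) + ∫ x, w x ^ 2 ∂(P.prod Q) := by
    have : ∀ x, (1 - w x) ^ 2 = 1 - 2 * w x + w x ^ 2 := fun x => by ring
    simp_rw [this]
    rw [integral_add (f := fun x => 1 - 2 * w x)
        ((integrable_const _).sub (iw.const_mul 2)) iw2,
      integral_sub (integrable_const _) (iw.const_mul 2), integral_const_mul]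
    simp
  have f2 : ∀ c : ℝ, ∫ x, (w x - c) ^ 2 ∂(P.prod Q)
      = ∫ x, w x ^ 2 ∂(P.prod Q) - 2 * c * ∫ x, w x ∂(P.prod Q) + c ^ 2 := by
    intro c
    have : ∀ x, (w x - c) ^ 2 = w x ^ 2 - 2 * c * w x + c ^ 2 := fun x => by ring
    simp_rw [this]
    rw [integral_add (f := fun x => w x ^ 2 - 2 * c * w x)
        (iw2.sub (iw.const_mul (2 * c))) (integrable_const _),
      integral_sub iw2 (iw.const_mul (2 * c)), integral_const_mul]
    simp
  have e0 : ∀ x : (Fin n → ℝ) × (Fin n → ℝ),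
      (sampleMean n x.1 + (sampleMean n x.2 - sampleMean n x.1) *
        φ (sampleVar n x.1, sampleVar n x.2) - μ) ^ 2
      = (sampleMean n x.1 - μ) ^ 2 * (1 - w x) ^ 2 + (sampleMean n x.2 - μ) ^ 2 * w x ^ 2
        + 2 * ((sampleMean n x.1 - μ) * (sampleMean n x.2 - μ) * (w x * (1 - w x))) := by
    intro x; simp only [hw]; ring
  simp_rw [e0]
  change _ = _ + _ * ∫ x, (w x - v₁ / (v₁ + v₂)) ^ 2 ∂(P.prod Q)
  rw [integral_add (i1.fun_add i2) (i3.const_mul 2), integral_add i1 i2, integral_const_mul,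
    e1, e2, e3, f2, f1]
  have : v₁ + v₂ ≠ 0 := by positivity
  field_simp
  ring
end
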